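/- arXiv:2508.01632 — 3 statements merged into one kernel-verified Lean document; each statement's English description precedes it below -/
import Mathlib

section
/- Let U ⊂ ℝ² be an open disk centered at a point p, and let f be a bounded function that is smooth on an open neighborhood of the closure of U minus {p}, whose Laplacian Δf is Lebesgue integrable on U∖{p}. Then the distributional Laplacian of f on U (viewing the bounded function f as a distribution on U) coincides with the distribution defined by the locally integrable function Δf; that is, for every smooth compactly supported test function φ on U, ∫_{U} f·Δφ dx dy = ∫_{U∖{p}} (Δf)·φ dx dy. -/
open MeasureTheory

/-- The standard Laplacian on `ℝ² ≅ ℂ`: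
`Δf(z) = ∂²f/∂x²(z) + ∂²f/∂y²(z)`. -/
noncomputable def pLaplacian (f : ℂ → ℝ) (z : ℂ) : ℝ :=
  iteratedDeriv 2 (fun x : ℝ => f ((x : ℂ) + (z.im : ℂ) * Complex.I)) z.re +
  iteratedDeriv 2 (fun y : ℝ => f ((z.re : ℂ) + (y : ℂ) * Complex.I)) z.im

open Filter Topology

section Laplacian

variable {f g : ℂ → ℝ} {s : Set ℂ} {v z : ℂ}

lemma ContDiffAt.iteratedDeriv_two_line {t : ℝ} (h : ContDiffAt ℝ 2 g (z + (t : ℂ) * v)) :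
    iteratedDeriv 2 (fun x : ℝ => g (z + (x : ℂ) * v)) t
      = fderiv ℝ (fun w => fderiv ℝ g w v) (z + (t : ℂ) * v) v := by
  have hl (x : ℝ) : HasDerivAt (fun x : ℝ => z + (x : ℂ) * v) v x := by
    simpa using ((Complex.ofRealCLM.hasDerivAt (x := x)).mul_const v).const_add z
  have h1 : ∀ᶠ w in 𝓝 (z + (t : ℂ) * v), ContDiffAt ℝ 2 g w := h.eventually (by simp)
  have h2 : deriv (fun x : ℝ => g (z + (x : ℂ) * v))
      =ᶠ[𝓝 t] fun x => fderiv ℝ g (z + (x : ℂ) * v) v := by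
    filter_upwards [(hl t).continuousAt.eventually h1] with x hx
    exact ((hx.differentiableAt (by simp)).hasFDerivAt.comp_hasDerivAt x (hl x)).deriv
  rw [iteratedDeriv_succ, iteratedDeriv_one, h2.deriv_eq]
  have h3 : DifferentiableAt ℝ (fun w => fderiv ℝ g w v) (z + (t : ℂ) * v) :=
    ((h.fderiv_right (m := 1) (by norm_num)).differentiableAt (by simp)).clm_apply
      (differentiableAt_const v)
  exact (h3.hasFDerivAt.comp_hasDerivAt t (hl t)).deriv

lemma ContDiffAt.pLaplacian_eq (h : ContDiffAt ℝ 2 g z) :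
    pLaplacian g z = fderiv ℝ (fun w => fderiv ℝ g w 1) z 1
      + fderiv ℝ (fun w => fderiv ℝ g w Complex.I) z Complex.I := by
  have e1 : (z.im : ℂ) * Complex.I + (z.re : ℂ) * 1 = z := by
    rw [mul_one, add_comm, Complex.re_add_im]
  have e2 : (z.re : ℂ) + (z.im : ℂ) * Complex.I = z := Complex.re_add_im z
  have h1 := ContDiffAt.iteratedDeriv_two_line (g := g) (z := (z.im : ℂ) * Complex.I) (v := 1)
    (t := z.re) (by rwa [e1])
  have h2 := ContDiffAt.iteratedDeriv_two_line (g := g) (z := (z.re : ℂ)) (v := Complex.I)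
    (t := z.im) (by rwa [e2])
  rw [e1] at h1
  rw [e2] at h2
  rw [pLaplacian, ← h1, ← h2]
  simp only [mul_one, add_comm]

lemma ContDiff.fderiv_const_apply (hg : ContDiff ℝ (⊤ : ℕ∞) g) (v : ℂ) :
    ContDiff ℝ (⊤ : ℕ∞) fun w => fderiv ℝ g w v :=
  (hg.fderiv_right (by simp)).clm_apply contDiff_const

lemma ContDiffOn.fderiv_const_apply (hs : IsOpen s) (hf : ContDiffOn ℝ (⊤ : ℕ∞) f s) (v : ℂ) :
    ContDiffOn ℝ (⊤ : ℕ∞) (fun w => fderiv ℝ f w v) s :=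
  (hf.fderiv_of_isOpen hs (by simp)).clm_apply contDiffOn_const

lemma ContDiff.continuous_pLaplacian (hg : ContDiff ℝ (⊤ : ℕ∞) g) : Continuous (pLaplacian g) := by
  have : pLaplacian g = fun z => fderiv ℝ (fun w => fderiv ℝ g w 1) z 1
      + fderiv ℝ (fun w => fderiv ℝ g w Complex.I) z Complex.I :=
    funext fun z => (hg.contDiffAt.of_le ENat.LEInfty.out).pLaplacian_eq
  rw [this]
  exact ((hg.fderiv_const_apply 1).fderiv_const_apply 1).continuous.add
    ((hg.fderiv_const_apply _).fderiv_const_apply _).continuous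

lemma pLaplacian_eq_zero_of_notMem_tsupport (h : z ∉ tsupport g) : pLaplacian g z = 0 := by
  have h0 : g =ᶠ[𝓝 z] fun _ => 0 := notMem_tsupport_iff_eventuallyEq.mp h
  have h1 (v : ℂ) : fderiv ℝ (fun w => fderiv ℝ g w v) z v = 0 := by
    have : (fun w => fderiv ℝ g w v) =ᶠ[𝓝 z] fun _ => 0 := by
      filter_upwards [h0.fderiv (𝕜 := ℝ)] with w hw
      simp [hw]
    simp [this.fderiv_eq]
  rw [(contDiffAt_const.congr_of_eventuallyEq h0).pLaplacian_eq, h1, h1, add_zero]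

lemma ContinuousOn.integrable_mul_of_tsupport_subset (hf : ContinuousOn f s) (hg : Continuous g)
    (hc : HasCompactSupport g) (hs : tsupport g ⊆ s) : Integrable fun z => f z * g z := by
  refine (integrableOn_iff_integrable_of_support_subset (s := tsupport g) ?_).mp ?_
  · exact (Function.support_mul_subset_right f g).trans (subset_tsupport g)
  · exact ((hf.mono hs).mul hg.continuousOn).integrableOn_compact hc

lemma ContDiffOn.integral_mul_fderiv_fderiv (hs : IsOpen s) (hf : ContDiffOn ℝ (⊤ : ℕ∞) f s)
    (hg : ContDiff ℝ (⊤ : ℕ∞) g) (hc : HasCompactSupport g) (hgs : tsupport g ⊆ s) (v : ℂ) :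
    ∫ z, f z * fderiv ℝ (fun w => fderiv ℝ g w v) z v
      = ∫ z, fderiv ℝ (fun w => fderiv ℝ f w v) z v * g z := by
  have hg1 := hg.fderiv_const_apply v
  have hg2 := hg1.fderiv_const_apply v
  have hf1 := hf.fderiv_const_apply hs v
  have hf2 := hf1.fderiv_const_apply hs v
  have hc1 : HasCompactSupport fun w => fderiv ℝ g w v := hc.fderiv_apply ℝ v
  have hs1 : tsupport (fun w => fderiv ℝ g w v) ⊆ s :=
    (tsupport_fderiv_apply_subset ℝ v).trans hgs
  have hc2 : HasCompactSupport fun z => fderiv ℝ (fun w => fderiv ℝ g w v) z v :=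
    hc1.fderiv_apply ℝ v
  have hs2 : tsupport (fun z => fderiv ℝ (fun w => fderiv ℝ g w v) z v) ⊆ s :=
    (tsupport_fderiv_apply_subset ℝ v).trans hs1
  have hd {h : ℂ → ℝ} (hh : ContDiffOn ℝ (⊤ : ℕ∞) h s) (x : ℂ) (hx : x ∈ s) :
      DifferentiableAt ℝ h x := (hh.contDiffAt (hs.mem_nhds hx)).differentiableAt (by simp)
  rw [integral_mul_fderiv_eq_neg_fderiv_mul_of_integrable
      (hf1.continuousOn.integrable_mul_of_tsupport_subset hg1.continuous hc1 hs1)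
      (hf.continuousOn.integrable_mul_of_tsupport_subset hg2.continuous hc2 hs2)
      (hf.continuousOn.integrable_mul_of_tsupport_subset hg1.continuous hc1 hs1)
      (fun x hx => hd hf x (hs1 hx)) (fun x _ => hg1.differentiable (by simp) x),
    integral_mul_fderiv_eq_neg_fderiv_mul_of_integrable
      (hf2.continuousOn.integrable_mul_of_tsupport_subset hg.continuous hc hgs)
      (hf1.continuousOn.integrable_mul_of_tsupport_subset hg1.continuous hc1 hs1)
      (hf1.continuousOn.integrable_mul_of_tsupport_subset hg.continuous hc hgs)
      (fun x hx => hd hf1 x (hgs hx)) (fun x _ => hg.differentiable (by simp) x), neg_neg]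

lemma ContDiffOn.integral_mul_pLaplacian (hs : IsOpen s) (hf : ContDiffOn ℝ (⊤ : ℕ∞) f s)
    (hg : ContDiff ℝ (⊤ : ℕ∞) g) (hc : HasCompactSupport g) (hgs : tsupport g ⊆ s) :
    ∫ z, f z * pLaplacian g z = ∫ z, pLaplacian f z * g z := by
  have hi (v : ℂ) : Integrable fun z => f z * fderiv ℝ (fun w => fderiv ℝ g w v) z v := by
    refine hf.continuousOn.integrable_mul_of_tsupport_subset
      ((hg.fderiv_const_apply v).fderiv_const_apply v).continuous
      ((hc.fderiv_apply ℝ v).fderiv_apply ℝ v) ?_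
    exact (tsupport_fderiv_apply_subset ℝ v).trans
      ((tsupport_fderiv_apply_subset ℝ v).trans hgs)
  have hj (v : ℂ) : Integrable fun z => fderiv ℝ (fun w => fderiv ℝ f w v) z v * g z :=
    ((hf.fderiv_const_apply hs v).fderiv_const_apply hs
      v).continuousOn.integrable_mul_of_tsupport_subset hg.continuous hc hgs
  have e1 (z : ℂ) : f z * pLaplacian g z = f z * fderiv ℝ (fun w => fderiv ℝ g w 1) z 1
      + f z * fderiv ℝ (fun w => fderiv ℝ g w Complex.I) z Complex.I := by
    rw [(hg.contDiffAt.of_le ENat.LEInfty.out).pLaplacian_eq, mul_add]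
  have e2 (z : ℂ) : pLaplacian f z * g z = fderiv ℝ (fun w => fderiv ℝ f w 1) z 1 * g z
      + fderiv ℝ (fun w => fderiv ℝ f w Complex.I) z Complex.I * g z := by
    by_cases hz : z ∈ s
    · rw [((hf.contDiffAt (hs.mem_nhds hz)).of_le ENat.LEInfty.out).pLaplacian_eq,
        add_mul]
    · simp [image_eq_zero_of_notMem_tsupport fun h => hz (hgs h)]
  simp_rw [e1, e2]
  rw [integral_add (hi 1) (hi _), integral_add (hj 1) (hj _),
    hf.integral_mul_fderiv_fderiv hs hg hc hgs, hf.integral_mul_fderiv_fderiv hs hg hc hgs]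

lemma ContDiff.pLaplacian_mul (hf : ContDiff ℝ (⊤ : ℕ∞) f) (hg : ContDiff ℝ (⊤ : ℕ∞) g) (z : ℂ) :
    pLaplacian (fun w => f w * g w) z = f z * pLaplacian g z
      + (2 * (fderiv ℝ f z 1 * fderiv ℝ g z 1
        + fderiv ℝ f z Complex.I * fderiv ℝ g z Complex.I) + pLaplacian f z * g z) := by
  have h2 : (2 : WithTop ℕ∞) ≤ ((⊤ : ℕ∞) : WithTop ℕ∞) := ENat.LEInfty.out
  have hd {h : ℂ → ℝ} (hh : ContDiff ℝ (⊤ : ℕ∞) h) (z : ℂ) : DifferentiableAt ℝ h z :=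
    hh.differentiable (by simp) z
  have key (v : ℂ) : fderiv ℝ (fun w => fderiv ℝ (fun w => f w * g w) w v) z v
      = f z * fderiv ℝ (fun w => fderiv ℝ g w v) z v + 2 * (fderiv ℝ f z v * fderiv ℝ g z v)
        + fderiv ℝ (fun w => fderiv ℝ f w v) z v * g z := by
    have hf1 := hf.fderiv_const_apply v
    have hg1 := hg.fderiv_const_apply v
    have e : (fun w => fderiv ℝ (fun w => f w * g w) w v)
        = fun w => f w * fderiv ℝ g w v + g w * fderiv ℝ f w v := by
      ext w
      rw [fderiv_fun_mul (hd hf w) (hd hg w)]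
      simp
    rw [e, fderiv_fun_add ((hd hf z).fun_mul (hd hg1 z)) ((hd hg z).fun_mul (hd hf1 z)),
      fderiv_fun_mul (hd hf z) (hd hg1 z), fderiv_fun_mul (hd hg z) (hd hf1 z)]
    simp only [add_apply, smul_apply, smul_eq_mul]
    ring
  rw [((hf.mul hg).contDiffAt.of_le h2).pLaplacian_eq, (hf.contDiffAt.of_le h2).pLaplacian_eq,
    (hg.contDiffAt.of_le h2).pLaplacian_eq, key, key]
  ring

end Laplacian

section LogCutoff

/-- A smooth cutoff at `p` that is a function of `log ‖z - p‖ / a`: it vanishes for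
`‖z - p‖ ≤ exp (-a)` and equals `1` for `exp (-a / 2) ≤ ‖z - p‖`. -/
noncomputable def logCutoff (p : ℂ) (a : ℝ) (z : ℂ) : ℝ :=
  if z = p then 0 else
    Real.smoothTransition (2 + Real.log ((z.re - p.re) ^ 2 + (z.im - p.im) ^ 2) / a)

/-- The function `‖z - p‖⁻² / a²` on the annulus `exp (-a) ≤ ‖z - p‖ ≤ exp (-a / 2)`, extended
by zero. -/
noncomputable def annulusWeight (p : ℂ) (a : ℝ) (z : ℂ) : ℝ :=
  (Set.Icc (Real.exp (-a)) (Real.exp (-a / 2))).indicator (fun r => (a ^ 2 * r ^ 2)⁻¹) ‖z - p‖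

variable {p z : ℂ} {a : ℝ}

lemma sq_re_sub_add_sq_im_sub (z p : ℂ) :
    (z.re - p.re) ^ 2 + (z.im - p.im) ^ 2 = ‖z - p‖ ^ 2 := by
  rw [← Complex.normSq_eq_norm_sq, Complex.normSq_apply, Complex.sub_re, Complex.sub_im]
  ring

lemma logCutoff_of_ne (h : z ≠ p) : logCutoff p a z =
    Real.smoothTransition (2 + Real.log ((z.re - p.re) ^ 2 + (z.im - p.im) ^ 2) / a) :=
  if_neg h

lemma logCutoff_nonneg : 0 ≤ logCutoff p a z := by
  unfold logCutoff
  split_ifs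
  exacts [le_rfl, Real.smoothTransition.nonneg _]

lemma logCutoff_le_one : logCutoff p a z ≤ 1 := by
  unfold logCutoff
  split_ifs
  exacts [zero_le_one, Real.smoothTransition.le_one _]

lemma logCutoff_eq_zero (ha : 0 < a) (h : ‖z - p‖ ≤ Real.exp (-a)) : logCutoff p a z = 0 := by
  unfold logCutoff
  split_ifs with hz
  · rfl
  · apply Real.smoothTransition.zero_of_nonpos
    have h0 : 0 < ‖z - p‖ := norm_pos_iff.mpr (sub_ne_zero.mpr hz)
    have h1 := Real.log_le_log h0 h
    rw [Real.log_exp] at h1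
    have h2 : (2 * Real.log ‖z - p‖) / a ≤ -2 := by
      rw [div_le_iff₀ ha]; linarith
    rw [sq_re_sub_add_sq_im_sub, Real.log_pow]
    push_cast
    linarith

lemma logCutoff_eventuallyEq_zero (ha : 0 < a) : logCutoff p a =ᶠ[𝓝 p] fun _ => 0 := by
  filter_upwards [Metric.closedBall_mem_nhds p (Real.exp_pos (-a))] with z hz
  exact logCutoff_eq_zero ha (by simpa [dist_eq_norm] using hz)

lemma notMem_tsupport_logCutoff (ha : 0 < a) : p ∉ tsupport (logCutoff p a) :=
  notMem_tsupport_iff_eventuallyEq.mpr (logCutoff_eventuallyEq_zero ha)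

lemma tendsto_logCutoff (h : z ≠ p) : Tendsto (fun a => logCutoff p a z) atTop (𝓝 1) := by
  have h1 : Tendsto (fun a => Real.log ((z.re - p.re) ^ 2 + (z.im - p.im) ^ 2) / a) atTop (𝓝 0) :=
    tendsto_const_nhds.div_atTop tendsto_id
  apply tendsto_const_nhds.congr'
  filter_upwards [h1.eventually (lt_mem_nhds (by norm_num : (-1 : ℝ) < 0))] with a ha
  rw [logCutoff_of_ne h, Real.smoothTransition.one_of_one_le (by linarith)]

lemma sq_re_sub_add_sq_im_sub_pos (h : z ≠ p) : 0 < (z.re - p.re) ^ 2 + (z.im - p.im) ^ 2 := by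
  rw [sq_re_sub_add_sq_im_sub]
  exact pow_pos (norm_pos_iff.mpr (sub_ne_zero.mpr h)) 2

lemma contDiff_logCutoff (ha : 0 < a) : ContDiff ℝ (⊤ : ℕ∞) (logCutoff p a) := by
  rw [contDiff_iff_contDiffAt]
  intro z
  by_cases hz : z = p
  · subst hz
    exact contDiffAt_const.congr_of_eventuallyEq (logCutoff_eventuallyEq_zero ha)
  · have h : logCutoff p a =ᶠ[𝓝 z] fun z =>
        Real.smoothTransition (2 + Real.log ((z.re - p.re) ^ 2 + (z.im - p.im) ^ 2) / a) := by
      filter_upwards [isOpen_ne.mem_nhds hz] with w hw using logCutoff_of_ne hw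
    refine ContDiffAt.congr_of_eventuallyEq ?_ h
    have hre : ContDiffAt ℝ (⊤ : ℕ∞) (fun z : ℂ => z.re) z := Complex.reCLM.contDiff.contDiffAt
    have him : ContDiffAt ℝ (⊤ : ℕ∞) (fun z : ℂ => z.im) z := Complex.imCLM.contDiff.contDiffAt
    have hq : ContDiffAt ℝ (⊤ : ℕ∞) (fun z : ℂ => (z.re - p.re) ^ 2 + (z.im - p.im) ^ 2) z :=
      ((hre.sub contDiffAt_const).pow 2).add ((him.sub contDiffAt_const).pow 2)
    exact Real.smoothTransition.contDiffAt.comp z (contDiffAt_const.add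
      ((hq.log (sq_re_sub_add_sq_im_sub_pos hz).ne').div_const a))

lemma hasFDerivAt_sq_re_sub_add_sq_im_sub (p z : ℂ) :
    HasFDerivAt (fun z : ℂ => (z.re - p.re) ^ 2 + (z.im - p.im) ^ 2)
      ((2 * (z.re - p.re)) • Complex.reCLM + (2 * (z.im - p.im)) • Complex.imCLM) z := by
  have hre : HasFDerivAt (fun z : ℂ => z.re - p.re) Complex.reCLM z :=
    Complex.reCLM.hasFDerivAt.sub_const _
  have him : HasFDerivAt (fun z : ℂ => z.im - p.im) Complex.imCLM z :=
    Complex.imCLM.hasFDerivAt.sub_const _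
  simpa using (hre.pow 2).fun_add (him.pow 2)

lemma hasFDerivAt_comp_log {η : ℝ → ℝ} (hη : Differentiable ℝ η) (h : z ≠ p) :
    HasFDerivAt (fun z : ℂ => η (2 + Real.log ((z.re - p.re) ^ 2 + (z.im - p.im) ^ 2) / a))
      (deriv η (2 + Real.log ((z.re - p.re) ^ 2 + (z.im - p.im) ^ 2) / a) •
        a⁻¹ • ((z.re - p.re) ^ 2 + (z.im - p.im) ^ 2)⁻¹ •
        ((2 * (z.re - p.re)) • Complex.reCLM + (2 * (z.im - p.im)) • Complex.imCLM)) z := by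
  have h1 := ((hasFDerivAt_sq_re_sub_add_sq_im_sub p z).log
    (sq_re_sub_add_sq_im_sub_pos h).ne').mul_const a⁻¹
  exact (hη _).hasDerivAt.comp_hasFDerivAt z (h1.const_add 2)

lemma fderiv_logCutoff (h : z ≠ p) (v : ℂ) : fderiv ℝ (logCutoff p a) z v =
    deriv Real.smoothTransition (2 + Real.log ((z.re - p.re) ^ 2 + (z.im - p.im) ^ 2) / a) *
      (2 * ((z.re - p.re) * v.re + (z.im - p.im) * v.im) *
        (a * ((z.re - p.re) ^ 2 + (z.im - p.im) ^ 2))⁻¹) := by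
  have h1 : logCutoff p a =ᶠ[𝓝 z] fun z =>
      Real.smoothTransition (2 + Real.log ((z.re - p.re) ^ 2 + (z.im - p.im) ^ 2) / a) := by
    filter_upwards [isOpen_ne.mem_nhds h] with w hw using logCutoff_of_ne hw
  rw [h1.fderiv_eq, (hasFDerivAt_comp_log
    (Real.smoothTransition.contDiff.differentiable (n := 1) (by simp)) h).fderiv]
  simp only [smul_apply, add_apply, smul_eq_mul, Complex.reCLM_apply, Complex.imCLM_apply, mul_inv]
  ring

lemma fderiv_fderiv_logCutoff (h : z ≠ p) (v : ℂ) :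
    fderiv ℝ (fun w => fderiv ℝ (logCutoff p a) w v) z v =
    deriv (deriv Real.smoothTransition)
        (2 + Real.log ((z.re - p.re) ^ 2 + (z.im - p.im) ^ 2) / a) *
      (2 * ((z.re - p.re) * v.re + (z.im - p.im) * v.im) *
        (a * ((z.re - p.re) ^ 2 + (z.im - p.im) ^ 2))⁻¹) ^ 2 +
    deriv Real.smoothTransition (2 + Real.log ((z.re - p.re) ^ 2 + (z.im - p.im) ^ 2) / a) *
      (2 * (v.re ^ 2 + v.im ^ 2) * (a * ((z.re - p.re) ^ 2 + (z.im - p.im) ^ 2))⁻¹ -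
        4 * ((z.re - p.re) * v.re + (z.im - p.im) * v.im) ^ 2 *
        (a * ((z.re - p.re) ^ 2 + (z.im - p.im) ^ 2) ^ 2)⁻¹) := by
  have h1 : (fun w => fderiv ℝ (logCutoff p a) w v) =ᶠ[𝓝 z] fun z =>
      deriv Real.smoothTransition (2 + Real.log ((z.re - p.re) ^ 2 + (z.im - p.im) ^ 2) / a) *
        ((2 * ((z.re - p.re) * v.re + (z.im - p.im) * v.im)) *
          (((z.re - p.re) ^ 2 + (z.im - p.im) ^ 2)⁻¹ * a⁻¹)) := by
    filter_upwards [isOpen_ne.mem_nhds h] with w hw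
    rw [fderiv_logCutoff hw, mul_inv]
    ring
  have hη : Differentiable ℝ (deriv Real.smoothTransition) :=
    (contDiff_infty_iff_deriv.mp Real.smoothTransition.contDiff).2.differentiable (by simp)
  have hq := sq_re_sub_add_sq_im_sub_pos h
  have h2 := hasFDerivAt_comp_log (a := a) hη h
  have hre : HasFDerivAt (fun z : ℂ => z.re - p.re) Complex.reCLM z :=
    Complex.reCLM.hasFDerivAt.sub_const _
  have him : HasFDerivAt (fun z : ℂ => z.im - p.im) Complex.imCLM z :=
    Complex.imCLM.hasFDerivAt.sub_const _
  have h3 := ((hre.mul_const v.re).fun_add (him.mul_const v.im)).const_mul (2 : ℝ)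
  have h4 := ((hasDerivAt_inv hq.ne').comp_hasFDerivAt z
    (hasFDerivAt_sq_re_sub_add_sq_im_sub p z)).mul_const a⁻¹
  have h5 := h2.fun_mul (h3.fun_mul h4)
  rw [(h5.congr_of_eventuallyEq h1).fderiv]
  simp only [smul_apply, add_apply, smul_eq_mul, Complex.reCLM_apply, Complex.imCLM_apply,
    Function.comp_apply]
  rcases eq_or_ne a 0 with rfl | ha
  · simp
  field_simp
  ring

lemma pLaplacian_logCutoff (ha : 0 < a) (h : z ≠ p) : pLaplacian (logCutoff p a) z =
    deriv (deriv Real.smoothTransition)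
        (2 + Real.log ((z.re - p.re) ^ 2 + (z.im - p.im) ^ 2) / a) *
      (4 * (a ^ 2 * ((z.re - p.re) ^ 2 + (z.im - p.im) ^ 2))⁻¹) := by
  have hq := sq_re_sub_add_sq_im_sub_pos h
  rw [((contDiff_logCutoff ha).contDiffAt.of_le ENat.LEInfty.out).pLaplacian_eq,
    fderiv_fderiv_logCutoff h, fderiv_fderiv_logCutoff h]
  simp only [Complex.one_re, Complex.one_im, Complex.I_re, Complex.I_im]
  field_simp
  ring

lemma deriv_smoothTransition_of_notMem {t : ℝ} (h : t ∉ Set.Icc (0 : ℝ) 1) :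
    deriv Real.smoothTransition t = 0 ∧ deriv (deriv Real.smoothTransition) t = 0 := by
  obtain ⟨c, hc⟩ : ∃ c : ℝ, Real.smoothTransition =ᶠ[𝓝 t] fun _ => c := by
    rw [Set.mem_Icc, not_and_or, not_le, not_le] at h
    rcases h with h | h
    · refine ⟨0, ?_⟩
      filter_upwards [gt_mem_nhds h] with s hs using Real.smoothTransition.zero_of_nonpos hs.le
    · refine ⟨1, ?_⟩
      filter_upwards [lt_mem_nhds h] with s hs using Real.smoothTransition.one_of_one_le hs.le
  have h1 := hc.deriv
  rw [deriv_const'] at h1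
  exact ⟨h1.eq_of_nhds, by rw [h1.deriv_eq, deriv_const]⟩

lemma exists_bound_deriv_smoothTransition : ∃ C, 0 ≤ C ∧ ∀ t,
    |deriv Real.smoothTransition t| ≤ C ∧ |deriv (deriv Real.smoothTransition) t| ≤ C := by
  have hη := (contDiff_infty_iff_deriv.mp Real.smoothTransition.contDiff).2
  obtain ⟨C₁, h₁⟩ := isCompact_Icc.exists_bound_of_continuousOn (s := Set.Icc (0 : ℝ) 1)
    hη.continuous.continuousOn
  obtain ⟨C₂, h₂⟩ := isCompact_Icc.exists_bound_of_continuousOn (s := Set.Icc (0 : ℝ) 1)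
    (contDiff_infty_iff_deriv.mp hη).2.continuous.continuousOn
  refine ⟨max 0 (max C₁ C₂), le_max_left _ _, fun t => ?_⟩
  by_cases ht : t ∈ Set.Icc (0 : ℝ) 1
  · exact ⟨(h₁ t ht).trans ((le_max_left _ _).trans (le_max_right _ _)),
      (h₂ t ht).trans ((le_max_right _ _).trans (le_max_right _ _))⟩
  · obtain ⟨e₁, e₂⟩ := deriv_smoothTransition_of_notMem ht
    simp [e₁, e₂]

lemma annulusWeight_nonneg : 0 ≤ annulusWeight p a z :=
  Set.indicator_nonneg (fun _ _ => by positivity) _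

lemma mul_exp_neg_half_le_one (ha : 0 < a) : a * Real.exp (-a / 2) ≤ 1 := by
  have h1 : a ≤ Real.exp (a / 2) := by
    have h2 : a / 4 + 1 ≤ Real.exp (a / 4) := Real.add_one_le_exp _
    have h3 : Real.exp (a / 2) = Real.exp (a / 4) ^ 2 := by rw [← Real.exp_nat_mul]; ring_nf
    rw [h3]
    nlinarith [sq_nonneg (a / 4 - 1)]
  calc a * Real.exp (-a / 2) ≤ Real.exp (a / 2) * Real.exp (-a / 2) := by gcongr
    _ = 1 := by rw [← Real.exp_add]; ring_nf; simp

lemma exists_bound_logCutoff (p : ℂ) : ∃ C, 0 ≤ C ∧ ∀ a, 0 < a → ∀ z,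
    |fderiv ℝ (logCutoff p a) z 1| ≤ C * annulusWeight p a z ∧
    |fderiv ℝ (logCutoff p a) z Complex.I| ≤ C * annulusWeight p a z ∧
    |pLaplacian (logCutoff p a) z| ≤ C * annulusWeight p a z := by
  obtain ⟨C, hC, hb⟩ := exists_bound_deriv_smoothTransition
  refine ⟨4 * C, by positivity, fun a ha z => ?_⟩
  have hW : 0 ≤ 4 * C * annulusWeight p a z := mul_nonneg (by positivity) annulusWeight_nonneg
  by_cases hz : z = p
  · subst hz
    rw [pLaplacian_eq_zero_of_notMem_tsupport (notMem_tsupport_logCutoff ha),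
      (logCutoff_eventuallyEq_zero ha).fderiv_eq]
    simpa using hW
  rw [pLaplacian_logCutoff ha hz, fderiv_logCutoff hz, fderiv_logCutoff hz]
  simp only [Complex.one_re, Complex.one_im, Complex.I_re, Complex.I_im, mul_one, mul_zero,
    add_zero, zero_add]
  set t := 2 + Real.log ((z.re - p.re) ^ 2 + (z.im - p.im) ^ 2) / a with ht
  obtain ⟨hb1, hb2⟩ := hb t
  by_cases hw : t ∈ Set.Icc (0 : ℝ) 1
  · have hr : 0 < ‖z - p‖ := norm_pos_iff.mpr (sub_ne_zero.mpr hz)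
    rw [sq_re_sub_add_sq_im_sub] at ht ⊢
    have hlog : 2 * Real.log ‖z - p‖ = (t - 2) * a := by
      rw [ht, Real.log_pow]
      push_cast
      field_simp
      ring
    have hmem : ‖z - p‖ ∈ Set.Icc (Real.exp (-a)) (Real.exp (-a / 2)) := by
      rw [Set.mem_Icc, ← Real.le_log_iff_exp_le hr, ← Real.log_le_iff_le_exp hr]
      constructor <;> nlinarith [hw.1, hw.2]
    have har : a * ‖z - p‖ ≤ 1 :=
      (mul_le_mul_of_nonneg_left hmem.2 ha.le).trans (mul_exp_neg_half_le_one ha)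
    rw [annulusWeight, Set.indicator_of_mem hmem]
    have hx : |z.re - p.re| ≤ ‖z - p‖ := by simpa using Complex.abs_re_le_norm (z - p)
    have hy : |z.im - p.im| ≤ ‖z - p‖ := by simpa using Complex.abs_im_le_norm (z - p)
    have key (x : ℝ) (hx : |x| ≤ ‖z - p‖) :
        |deriv Real.smoothTransition t * (2 * x * (a * ‖z - p‖ ^ 2)⁻¹)|
          ≤ 4 * C * (a ^ 2 * ‖z - p‖ ^ 2)⁻¹ := by
      have h1 : |x| * a ≤ 1 := (mul_le_mul_of_nonneg_right hx ha.le).trans (by linarith)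
      have h2 : (a * ‖z - p‖ ^ 2)⁻¹ = a * (a ^ 2 * ‖z - p‖ ^ 2)⁻¹ := by field_simp
      have h3 : |2 * x * (a * ‖z - p‖ ^ 2)⁻¹| = 2 * (|x| * a) * (a ^ 2 * ‖z - p‖ ^ 2)⁻¹ := by
        rw [abs_mul, abs_mul, abs_of_pos (by positivity : 0 < (a * ‖z - p‖ ^ 2)⁻¹), abs_two, h2]
        ring
      rw [abs_mul, h3, mul_comm 4 C, mul_assoc C]
      refine mul_le_mul hb1 ?_ (by positivity) hC
      gcongr
      linarith
    refine ⟨key _ hx, key _ hy, ?_⟩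
    rw [abs_mul, mul_comm 4 C, mul_assoc,
      abs_of_pos (by positivity : 0 < 4 * (a ^ 2 * ‖z - p‖ ^ 2)⁻¹)]
    gcongr
  · obtain ⟨e₁, e₂⟩ := deriv_smoothTransition_of_notMem hw
    simpa [e₁, e₂] using hW

lemma pow_finrank_smul_indicator_annulus (a y : ℝ) :
    y ^ (Module.finrank ℝ ℂ - 1) • (Set.Icc (Real.exp (-a)) (Real.exp (-a / 2))).indicator
      (fun r => (a ^ 2 * r ^ 2)⁻¹) y
    = (Set.Icc (Real.exp (-a)) (Real.exp (-a / 2))).indicator (fun r => (a ^ 2)⁻¹ * r⁻¹) y := by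
  rw [Complex.finrank_real_complex]
  by_cases hy : y ∈ Set.Icc (Real.exp (-a)) (Real.exp (-a / 2))
  · have h0 : 0 < y := (Real.exp_pos _).trans_le hy.1
    rw [Set.indicator_of_mem hy, Set.indicator_of_mem hy, smul_eq_mul, Nat.add_one_sub_one, pow_one]
    field_simp
  · simp [Set.indicator_of_notMem hy]

lemma integrable_annulusWeight (p : ℂ) (a : ℝ) : Integrable (annulusWeight p a) := by
  have h : Integrable (fun z : ℂ => (Set.Icc (Real.exp (-a)) (Real.exp (-a / 2))).indicator
      (fun r => (a ^ 2 * r ^ 2)⁻¹) ‖z‖) := by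
    rw [integrable_fun_norm_addHaar volume]
    simp_rw [pow_finrank_smul_indicator_annulus]
    refine (Integrable.integrableOn ?_)
    rw [integrable_indicator_iff measurableSet_Icc]
    refine ContinuousOn.integrableOn_compact isCompact_Icc (continuousOn_const.mul ?_)
    exact continuousOn_inv₀.mono fun y hy => ((Real.exp_pos _).trans_le hy.1).ne'
  exact h.comp_sub_right p

lemma integral_annulusWeight (p : ℂ) (ha : 0 < a) :
    ∫ z, annulusWeight p a z = volume.real (Metric.ball (0 : ℂ) 1) / a := by
  have h : ∫ z, annulusWeight p a z = ∫ z : ℂ,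
      (Set.Icc (Real.exp (-a)) (Real.exp (-a / 2))).indicator (fun r => (a ^ 2 * r ^ 2)⁻¹) ‖z‖ :=
    integral_sub_right_eq_self (fun z : ℂ => (Set.Icc (Real.exp (-a)) (Real.exp (-a / 2))).indicator
      (fun r => (a ^ 2 * r ^ 2)⁻¹) ‖z‖) p
  have hsub : Set.Icc (Real.exp (-a)) (Real.exp (-a / 2)) ⊆ Set.Ioi 0 :=
    fun y hy => (Real.exp_pos _).trans_le hy.1
  rw [h, integral_fun_norm_addHaar volume]
  simp_rw [pow_finrank_smul_indicator_annulus]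
  rw [setIntegral_indicator measurableSet_Icc, Set.inter_eq_right.mpr hsub,
    integral_Icc_eq_integral_Ioc,
    ← intervalIntegral.integral_of_le (Real.exp_le_exp.mpr (by linarith)),
    intervalIntegral.integral_const_mul, integral_inv_of_pos (Real.exp_pos _) (Real.exp_pos _),
    ← Real.exp_sub, Real.log_exp, Complex.finrank_real_complex]
  simp only [nsmul_eq_mul, smul_eq_mul]
  push_cast
  field_simp
  ring

lemma tendsto_integral_annulusWeight (p : ℂ) :
    Tendsto (fun a => ∫ z, annulusWeight p a z) atTop (𝓝 0) := by
  have h : Tendsto (fun a => volume.real (Metric.ball (0 : ℂ) 1) / a) atTop (𝓝 0) :=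
    tendsto_const_nhds.div_atTop tendsto_id
  apply h.congr'
  filter_upwards [eventually_gt_atTop 0] with a ha using (integral_annulusWeight p ha).symm

end LogCutoff

lemma HasCompactSupport.pLaplacian {g : ℂ → ℝ} (hc : HasCompactSupport g) :
    HasCompactSupport (pLaplacian g) :=
  HasCompactSupport.intro hc fun _ => pLaplacian_eq_zero_of_notMem_tsupport

lemma ContDiffOn.setIntegral_mul_pLaplacian {f g : ℂ → ℝ} {s t : Set ℂ} (hs : IsOpen s)
    (hf : ContDiffOn ℝ (⊤ : ℕ∞) f s) (hg : ContDiff ℝ (⊤ : ℕ∞) g) (hc : HasCompactSupport g)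
    (hgt : tsupport g ⊆ t) (hts : t ⊆ s) :
    ∫ z in t, f z * pLaplacian g z = ∫ z in t, pLaplacian f z * g z := by
  rw [setIntegral_eq_integral_of_forall_compl_eq_zero fun z hz => ?_,
    setIntegral_eq_integral_of_forall_compl_eq_zero fun z hz => ?_,
    hf.integral_mul_pLaplacian hs hg hc (hgt.trans hts)]
  · rw [image_eq_zero_of_notMem_tsupport fun h => hz (hgt h), mul_zero]
  · rw [pLaplacian_eq_zero_of_notMem_tsupport fun h => hz (hgt h), mul_zero]

lemma exists_bound_logCutoff_cross_terms (p : ℂ) {φ : ℂ → ℝ} (hφ : ContDiff ℝ (⊤ : ℕ∞) φ)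
    (hc : HasCompactSupport φ) : ∃ K, 0 ≤ K ∧ ∀ a, 0 < a → ∀ z,
    |2 * (fderiv ℝ (logCutoff p a) z 1 * fderiv ℝ φ z 1
      + fderiv ℝ (logCutoff p a) z Complex.I * fderiv ℝ φ z Complex.I)
      + pLaplacian (logCutoff p a) z * φ z| ≤ K * annulusWeight p a z := by
  obtain ⟨C, hC, hb⟩ := exists_bound_logCutoff p
  obtain ⟨B₀, h₀⟩ := hφ.continuous.bounded_above_of_compact_support hc
  obtain ⟨B₁, h₁⟩ := (hφ.fderiv_const_apply 1).continuous.bounded_above_of_compact_support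
    (hc.fderiv_apply ℝ 1)
  obtain ⟨B₂, h₂⟩ := (hφ.fderiv_const_apply
    Complex.I).continuous.bounded_above_of_compact_support (hc.fderiv_apply ℝ Complex.I)
  simp only [Real.norm_eq_abs] at h₀ h₁ h₂
  have hB₀ := (abs_nonneg _).trans (h₀ 0)
  have hB₁ := (abs_nonneg _).trans (h₁ 0)
  have hB₂ := (abs_nonneg _).trans (h₂ 0)
  refine ⟨C * (2 * (B₁ + B₂) + B₀), by positivity, fun a ha z => ?_⟩
  obtain ⟨b₁, b₂, b₃⟩ := hb a ha z
  have hW : 0 ≤ C * annulusWeight p a z := mul_nonneg hC annulusWeight_nonneg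
  have e₁ := mul_le_mul b₁ (h₁ z) (abs_nonneg _) hW
  have e₂ := mul_le_mul b₂ (h₂ z) (abs_nonneg _) hW
  have e₃ := mul_le_mul b₃ (h₀ z) (abs_nonneg _) hW
  rw [← abs_mul, abs_le] at e₁ e₂ e₃
  rw [abs_le]
  constructor <;> nlinarith [e₁.1, e₁.2, e₂.1, e₂.2, e₃.1, e₃.2]

/-- Let `U = B_R(p) ⊂ ℝ² ≅ ℂ` be an open disk centered at `p`, and let `f` be a bounded
function that is smooth on an open neighborhood `V` of the closure of `U` minus `{p}`,
whose Laplacian `Δf` is Lebesgue integrable on `U ∖ {p}`.  Then the distributional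
Laplacian of `f` on `U` coincides with the distribution defined by the locally integrable
function `Δf`: for every smooth compactly supported test function `φ` on `U`,
`∫_U f·Δφ = ∫_{U∖{p}} (Δf)·φ`. -/
theorem stmt5 (p : ℂ) (R : ℝ) (hR : 0 < R) (f : ℂ → ℝ)
    (V : Set ℂ) (hVopen : IsOpen V) (hUV : closure (Metric.ball p R) ⊆ V)
    (hf : ContDiffOn ℝ (⊤ : ℕ∞) f (V \ {p}))
    (hbd : ∃ M, ∀ z ∈ V \ {p}, |f z| ≤ M)
    (hint : IntegrableOn (pLaplacian f) (Metric.ball p R \ {p}) volume) :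
    ∀ φ : ℂ → ℝ, ContDiff ℝ (⊤ : ℕ∞) φ → HasCompactSupport φ →
      tsupport φ ⊆ Metric.ball p R →
      ∫ z in Metric.ball p R, f z * pLaplacian φ z
        = ∫ z in Metric.ball p R \ {p}, pLaplacian f z * φ z := by
  intro φ hφ hc hsupp
  obtain ⟨M, hM⟩ := hbd
  have hopen : IsOpen (V \ {p}) := hVopen.sdiff isClosed_singleton
  set S := Metric.ball p R \ {p}
  have hS : MeasurableSet S := measurableSet_ball.diff (measurableSet_singleton p)
  have hSV : S ⊆ V \ {p} := Set.sdiff_subset_sdiff_left (subset_closure.trans hUV)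
  have hfm : AEStronglyMeasurable f (volume.restrict S) :=
    (hf.continuousOn.mono hSV).aestronglyMeasurable hS
  have hfb : ∀ᵐ z ∂volume.restrict S, ‖f z‖ ≤ M :=
    (ae_restrict_mem hS).mono fun z hz => hM z (hSV hz)
  have hfi {g : ℂ → ℝ} (hg : Continuous g) (hgc : HasCompactSupport g) :
      Integrable (fun z => f z * g z) (volume.restrict S) :=
    (hg.integrable_of_hasCompactSupport hgc).integrableOn.bdd_mul hfm hfb
  rw [show ∫ z in Metric.ball p R, f z * pLaplacian φ z = ∫ z in S, f z * pLaplacian φ z from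
    setIntegral_congr_set (sdiff_null_ae_eq_self (measure_singleton p)).symm]
  have hχ {a : ℝ} (ha : 0 < a) := contDiff_logCutoff (p := p) ha
  have hprodc (a : ℝ) : HasCompactSupport fun z => logCutoff p a z * φ z := hc.mul_left
  have hkey (a : ℝ) (ha : 0 < a) :
      ∫ z in S, f z * pLaplacian (fun z => logCutoff p a z * φ z) z
        = ∫ z in S, pLaplacian f z * (logCutoff p a z * φ z) := by
    refine hf.setIntegral_mul_pLaplacian hopen ((hχ ha).mul hφ) (hprodc a) (fun z hz => ?_) hSV
    exact ⟨hsupp (tsupport_mul_subset_right hz), fun h => notMem_tsupport_logCutoff ha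
      (h ▸ tsupport_mul_subset_left hz)⟩
  have habs (a : ℝ) (z : ℂ) : |logCutoff p a z| ≤ 1 := by
    rw [abs_of_nonneg logCutoff_nonneg]
    exact logCutoff_le_one
  have hne : ∀ᵐ z ∂volume.restrict S, z ≠ p := (ae_restrict_mem hS).mono fun z hz => hz.2
  obtain ⟨B, hB⟩ := hφ.continuous.bounded_above_of_compact_support hc
  have hright : Tendsto (fun a => ∫ z in S, pLaplacian f z * (logCutoff p a z * φ z)) atTop
      (𝓝 (∫ z in S, pLaplacian f z * φ z)) := by
    refine tendsto_integral_filter_of_dominated_convergence (fun z => ‖pLaplacian f z‖ * B)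
      ?_ ?_ (hint.norm.mul_const B) ?_
    · filter_upwards [eventually_gt_atTop 0] with a ha
      exact hint.aestronglyMeasurable.mul ((hχ ha).mul hφ).continuous.aestronglyMeasurable
    · refine .of_forall fun a => .of_forall fun z => ?_
      rw [norm_mul, norm_mul]
      gcongr
      exact (mul_le_of_le_one_left (norm_nonneg _) (habs a z)).trans (hB z)
    · filter_upwards [hne] with z hz
      simpa using ((tendsto_logCutoff hz).mul_const (φ z)).const_mul (pLaplacian f z)
  have hleft : Tendsto (fun a => ∫ z in S, f z * (logCutoff p a z * pLaplacian φ z)) atTop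
      (𝓝 (∫ z in S, f z * pLaplacian φ z)) := by
    refine tendsto_integral_filter_of_dominated_convergence (fun z => ‖f z * pLaplacian φ z‖)
      ?_ ?_ (hfi hφ.continuous_pLaplacian hc.pLaplacian).norm ?_
    · filter_upwards [eventually_gt_atTop 0] with a ha
      exact hfm.mul ((hχ ha).continuous.mul hφ.continuous_pLaplacian).aestronglyMeasurable
    · refine .of_forall fun a => .of_forall fun z => ?_
      rw [norm_mul, norm_mul, norm_mul]
      gcongr
      exact mul_le_of_le_one_left (norm_nonneg _) (habs a z)
    · filter_upwards [hne] with z hz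
      simpa using ((tendsto_logCutoff hz).mul_const (pLaplacian φ z)).const_mul (f z)
  obtain ⟨K, hK, hKb⟩ := exists_bound_logCutoff_cross_terms p hφ hc
  have hcross : Tendsto (fun a => ∫ z in S,
      (f z * pLaplacian (fun z => logCutoff p a z * φ z) z
        - f z * (logCutoff p a z * pLaplacian φ z))) atTop (𝓝 0) := by
    have hlim : Tendsto (fun a => |M| * K * ∫ z, annulusWeight p a z) atTop (𝓝 0) := by
      simpa using (tendsto_integral_annulusWeight p).const_mul (|M| * K)
    refine squeeze_zero_norm' ?_ hlim
    filter_upwards [eventually_gt_atTop 0] with a ha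
    have hi := (integrable_annulusWeight p a).const_mul (|M| * K)
    rw [← integral_const_mul]
    refine (norm_integral_le_of_norm_le hi.integrableOn ?_).trans
      (setIntegral_le_integral hi (.of_forall fun z => mul_nonneg (by positivity)
        annulusWeight_nonneg))
    filter_upwards [hfb] with z hz
    rw [(hχ ha).pLaplacian_mul hφ, ← mul_sub, add_sub_cancel_left, norm_mul, mul_assoc]
    exact mul_le_mul (hz.trans (le_abs_self M)) (hKb a ha z) (norm_nonneg _) (abs_nonneg M)
  refine tendsto_nhds_unique ?_ hright
  have hsum := hleft.add hcross
  rw [add_zero] at hsum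
  refine hsum.congr' ?_
  filter_upwards [eventually_gt_atTop 0] with a ha
  rw [integral_sub (hfi ((hχ ha).mul hφ).continuous_pLaplacian (hprodc a).pLaplacian)
    (hfi (g := fun z => logCutoff p a z * pLaplacian φ z) ((hχ ha).continuous.mul
      hφ.continuous_pLaplacian) hc.pLaplacian.mul_left),
    add_sub_cancel, hkey a ha]
end

section
/- Let U ⊂ ℝ² be an open disk centered at a point p, and let f be a bounded function that is smooth on an open neighborhood of the closure of U minus {p}, whose Laplacian Δf is Lebesgue integrable on U∖{p}. Then f has finite Dirichlet energy on U∖{p}: ∫_{U∖{p}} ((∂_x f)² + (∂_y f)²) dx dy < ∞. -/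
open MeasureTheory

/-- The partial derivative `∂_x f` on `ℝ² ≅ ℂ`. -/
noncomputable def pdx (f : ℂ → ℝ) (z : ℂ) : ℝ :=
  deriv (fun x : ℝ => f ((x : ℂ) + (z.im : ℂ) * Complex.I)) z.re

/-- The partial derivative `∂_y f` on `ℝ² ≅ ℂ`. -/
noncomputable def pdy (f : ℂ → ℝ) (z : ℂ) : ℝ :=
  deriv (fun y : ℝ => f ((z.re : ℂ) + (y : ℂ) * Complex.I)) z.im

lemma pLaplacian_eq (f : ℂ → ℝ) (z : ℂ) :
    pLaplacian f z = pdx (pdx f) z + pdy (pdy f) z := by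
  simp [pLaplacian, iteratedDeriv_succ, pdx, pdy]

lemma pdx_eq_fderiv {g : ℂ → ℝ} {z : ℂ} (hg : DifferentiableAt ℝ g z) :
    pdx g z = fderiv ℝ g z 1 := by
  have hz : ((z.re : ℝ) : ℂ) + (z.im : ℂ) * Complex.I = z := Complex.re_add_im z
  have h1 : HasDerivAt (fun x : ℝ => (x : ℂ) + (z.im : ℂ) * Complex.I) 1 z.re :=
    (Complex.ofRealCLM.hasDerivAt (x := z.re)).add_const _
  exact (HasFDerivAt.comp_hasDerivAt (l := g) z.re (by rw [hz]; exact hg.hasFDerivAt) h1).deriv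

lemma pdy_eq_fderiv {g : ℂ → ℝ} {z : ℂ} (hg : DifferentiableAt ℝ g z) :
    pdy g z = fderiv ℝ g z Complex.I := by
  have hz : ((z.re : ℝ) : ℂ) + (z.im : ℂ) * Complex.I = z := Complex.re_add_im z
  have h1 : HasDerivAt (fun y : ℝ => (z.re : ℂ) + (y : ℂ) * Complex.I) Complex.I z.im := by
    simpa using ((Complex.ofRealCLM.hasDerivAt (x := z.im)).mul_const Complex.I).const_add (z.re : ℂ)
  exact (HasFDerivAt.comp_hasDerivAt (l := g) z.im (by rw [hz]; exact hg.hasFDerivAt) h1).deriv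

/-- The integral of a directional derivative of a compactly supported `C¹` function vanishes. -/
lemma integral_fderiv_apply_eq_zero {u : ℂ → ℝ} (hu : ContDiff ℝ 1 u)
    (hc : HasCompactSupport u) (v : ℂ) : ∫ z, fderiv ℝ u z v = 0 := by
  have hi : Integrable (fun z => fderiv ℝ u z v) :=
    ((hu.continuous_fderiv one_ne_zero).clm_apply continuous_const).integrable_of_hasCompactSupport
      (hc.fderiv_apply ℝ v)
  have := integral_mul_fderiv_eq_neg_fderiv_mul_of_integrable (𝕜 := ℝ) (μ := volume)
    (f := fun _ : ℂ => (1 : ℝ)) (g := u) (v := v) (by simp) (by simpa using hi)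
    (by simpa using hu.continuous.integrable_of_hasCompactSupport hc)
    (by fun_prop) (fun z _ => hu.differentiable one_ne_zero z)
  simpa using this

lemma pdx_mul {g h : ℂ → ℝ} {z : ℂ} (hg : DifferentiableAt ℝ g z) (hh : DifferentiableAt ℝ h z) :
    pdx (g * h) z = g z * pdx h z + h z * pdx g z := by
  rw [pdx_eq_fderiv (hg.mul hh), pdx_eq_fderiv hg, pdx_eq_fderiv hh, fderiv_mul hg hh]
  simp

lemma pdy_mul {g h : ℂ → ℝ} {z : ℂ} (hg : DifferentiableAt ℝ g z) (hh : DifferentiableAt ℝ h z) :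
    pdy (g * h) z = g z * pdy h z + h z * pdy g z := by
  rw [pdy_eq_fderiv (hg.mul hh), pdy_eq_fderiv hg, pdy_eq_fderiv hh, fderiv_mul hg hh]
  simp

lemma ContDiffOn.fderiv_apply_of_isOpen {g : ℂ → ℝ} {W : Set ℂ} (hW : IsOpen W)
    (hg : ContDiffOn ℝ (⊤ : ℕ∞) g W) (v : ℂ) :
    ContDiffOn ℝ (⊤ : ℕ∞) (fun z => fderiv ℝ g z v) W :=
  (hg.fderiv_of_isOpen hW (by simp)).clm_apply contDiffOn_const

lemma ContDiffOn.pdx {g : ℂ → ℝ} {W : Set ℂ} (hW : IsOpen W)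
    (hg : ContDiffOn ℝ (⊤ : ℕ∞) g W) : ContDiffOn ℝ (⊤ : ℕ∞) (pdx g) W :=
  (hg.fderiv_apply_of_isOpen hW 1).congr fun z hz =>
    pdx_eq_fderiv ((hg.differentiableOn (by simp)).differentiableAt (hW.mem_nhds hz))

lemma ContDiffOn.pdy {g : ℂ → ℝ} {W : Set ℂ} (hW : IsOpen W)
    (hg : ContDiffOn ℝ (⊤ : ℕ∞) g W) : ContDiffOn ℝ (⊤ : ℕ∞) (pdy g) W :=
  (hg.fderiv_apply_of_isOpen hW Complex.I).congr fun z hz =>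
    pdy_eq_fderiv ((hg.differentiableOn (by simp)).differentiableAt (hW.mem_nhds hz))

lemma ContDiffOn.pLaplacian {g : ℂ → ℝ} {W : Set ℂ} (hW : IsOpen W)
    (hg : ContDiffOn ℝ (⊤ : ℕ∞) g W) : ContDiffOn ℝ (⊤ : ℕ∞) (pLaplacian g) W :=
  (((hg.pdx hW).pdx hW).add ((hg.pdy hW).pdy hW)).congr fun z _ => pLaplacian_eq g z

lemma contDiff_mul_of_tsupport_subset {φ g : ℂ → ℝ} {W : Set ℂ} {n : WithTop ℕ∞} (hW : IsOpen W)
    (hφ : ContDiff ℝ n φ) (hs : tsupport φ ⊆ W) (hg : ContDiffOn ℝ n g W) :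
    ContDiff ℝ n (φ * g) := by
  refine contDiff_iff_contDiffAt.2 fun z => ?_
  by_cases hz : z ∈ tsupport φ
  · exact hφ.contDiffAt.mul (hg.contDiffAt (hW.mem_nhds (hs hz)))
  · refine (contDiffAt_const (c := (0 : ℝ))).congr_of_eventuallyEq ?_
    filter_upwards [notMem_tsupport_iff_eventuallyEq.1 hz] with w hw
    simp [hw]

lemma continuous_mul_of_tsupport_subset {φ g : ℂ → ℝ} {W : Set ℂ} (hW : IsOpen W)
    (hφ : Continuous φ) (hs : tsupport φ ⊆ W) (hg : ContinuousOn g W) :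
    Continuous (φ * g) :=
  contDiff_zero.1 (contDiff_mul_of_tsupport_subset hW (contDiff_zero.2 hφ) hs
    (contDiffOn_zero.2 hg))

lemma integrable_sq_mul {φ g : ℂ → ℝ} {W : Set ℂ} (hW : IsOpen W) (hφ : Continuous φ)
    (hc : HasCompactSupport φ) (hs : tsupport φ ⊆ W) (hg : ContinuousOn g W) :
    Integrable (fun z => φ z ^ 2 * g z) := by
  have : (fun z => φ z ^ 2 * g z) = φ * (φ * g) := by
    funext z
    simp only [Pi.mul_apply]
    ring
  rw [this]
  exact (hφ.mul (continuous_mul_of_tsupport_subset hW hφ hs hg)).integrable_of_hasCompactSupport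
    hc.mul_right

/-- The Dirichlet energy density of `f`. -/
noncomputable def energyDensity (f : ℂ → ℝ) (z : ℂ) : ℝ := pdx f z ^ 2 + pdy f z ^ 2

lemma energyDensity_nonneg (f : ℂ → ℝ) (z : ℂ) : 0 ≤ energyDensity f z := by
  unfold energyDensity
  positivity

lemma ContDiffOn.energyDensity {g : ℂ → ℝ} {W : Set ℂ} (hW : IsOpen W)
    (hg : ContDiffOn ℝ (⊤ : ℕ∞) g W) : ContDiffOn ℝ (⊤ : ℕ∞) (energyDensity g) W :=
  ((hg.pdx hW).pow 2).add ((hg.pdy hW).pow 2)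

lemma energyDensity_eq_zero_of_notMem_tsupport {φ : ℂ → ℝ} (hφ : Differentiable ℝ φ) {z : ℂ}
    (hz : z ∉ tsupport φ) : energyDensity φ z = 0 := by
  have : fderiv ℝ φ z = 0 := by
    rw [(notMem_tsupport_iff_eventuallyEq.1 hz).fderiv_eq]
    simp
  simp [energyDensity, pdx_eq_fderiv (hφ z), pdy_eq_fderiv (hφ z), this]

lemma integrable_energyDensity {φ : ℂ → ℝ} (hφ : ContDiff ℝ (⊤ : ℕ∞) φ)
    (hc : HasCompactSupport φ) : Integrable (energyDensity φ) := by
  have h : ContDiff ℝ (⊤ : ℕ∞) (energyDensity φ) :=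
    contDiffOn_univ.1 (hφ.contDiffOn.energyDensity isOpen_univ)
  refine h.continuous.integrable_of_hasCompactSupport (HasCompactSupport.intro hc fun z hz => ?_)
  exact energyDensity_eq_zero_of_notMem_tsupport (hφ.differentiable (by simp)) hz

/-- The pointwise inequality behind the Caccioppoli estimate. -/
lemma half_sq_mul_le {a b l x y u v M : ℝ} (hb : |b| ≤ M) :
    a ^ 2 * (x ^ 2 + y ^ 2) / 2 ≤ (a ^ 2 * (b * l + x ^ 2 + y ^ 2) + 2 * a * b * (u * x + v * y)) +
      M * (a ^ 2 * |l|) + 2 * M ^ 2 * (u ^ 2 + v ^ 2) := by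
  have h1 : -(M * |l|) ≤ b * l := by
    have := neg_abs_le (b * l)
    rw [abs_mul] at this
    nlinarith [mul_le_mul_of_nonneg_right hb (abs_nonneg l)]
  have h2 : b ^ 2 ≤ M ^ 2 := sq_le_sq.2 (hb.trans (le_abs_self M))
  nlinarith [mul_le_mul_of_nonneg_left h1 (sq_nonneg a), sq_nonneg (a * x + 2 * b * u),
    sq_nonneg (a * y + 2 * b * v),
    mul_le_mul_of_nonneg_right h2 (add_nonneg (sq_nonneg u) (sq_nonneg v))]

/-- **Caccioppoli estimate** for a bounded function with a compactly supported cutoff. -/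
lemma integral_sq_mul_energyDensity_le {W : Set ℂ} (hW : IsOpen W) {f φ : ℂ → ℝ} {M : ℝ}
    (hf : ContDiffOn ℝ (⊤ : ℕ∞) f W) (hM : ∀ z ∈ W, |f z| ≤ M)
    (hφ : ContDiff ℝ (⊤ : ℕ∞) φ) (hc : HasCompactSupport φ) (hs : tsupport φ ⊆ W) :
    ∫ z, φ z ^ 2 * energyDensity f z ≤
      2 * M * (∫ z, φ z ^ 2 * |pLaplacian f z|) + 4 * M ^ 2 * ∫ z, energyDensity φ z := by
  have hfx := hf.pdx hW
  have hfy := hf.pdy hW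
  set u : ℂ → ℝ := φ * (φ * (f * pdx f)) with hu
  set v : ℂ → ℝ := φ * (φ * (f * pdy f)) with hv
  have hu1 : ContDiff ℝ (⊤ : ℕ∞) u :=
    hφ.mul (contDiff_mul_of_tsupport_subset hW hφ hs (hf.mul hfx))
  have hv1 : ContDiff ℝ (⊤ : ℕ∞) v :=
    hφ.mul (contDiff_mul_of_tsupport_subset hW hφ hs (hf.mul hfy))
  have huc : HasCompactSupport u := hc.mul_right
  have hvc : HasCompactSupport v := hc.mul_right
  have hi1 : Integrable (fun z => fderiv ℝ u z 1) :=
    ((hu1.continuous_fderiv (by simp)).clm_apply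
      continuous_const).integrable_of_hasCompactSupport (huc.fderiv_apply ℝ 1)
  have hi2 : Integrable (fun z => fderiv ℝ v z Complex.I) :=
    ((hv1.continuous_fderiv (by simp)).clm_apply
      continuous_const).integrable_of_hasCompactSupport (hvc.fderiv_apply ℝ Complex.I)
  have hiE := integrable_sq_mul hW hφ.continuous hc hs (hf.energyDensity hW).continuousOn
  have hiL := integrable_sq_mul hW hφ.continuous hc hs (hf.pLaplacian hW).continuousOn.abs
  have hiφ := integrable_energyDensity hφ hc
  have key : ∀ z, φ z ^ 2 * energyDensity f z / 2 ≤ (fderiv ℝ u z 1 + fderiv ℝ v z Complex.I) +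
      M * (φ z ^ 2 * |pLaplacian f z|) + 2 * M ^ 2 * energyDensity φ z := by
    intro z
    rw [← pdx_eq_fderiv (hu1.differentiable (by simp) z),
      ← pdy_eq_fderiv (hv1.differentiable (by simp) z)]
    by_cases hz : z ∈ tsupport φ
    · have hzW := hW.mem_nhds (hs hz)
      have dφ : DifferentiableAt ℝ φ z := hφ.differentiable (by simp) z
      have df : DifferentiableAt ℝ f z := (hf.contDiffAt hzW).differentiableAt (by simp)
      have dx : DifferentiableAt ℝ (pdx f) z := (hfx.contDiffAt hzW).differentiableAt (by simp)
      have dy : DifferentiableAt ℝ (pdy f) z := (hfy.contDiffAt hzW).differentiableAt (by simp)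
      rw [hu, hv, pdx_mul dφ (dφ.mul (df.mul dx)), pdx_mul dφ (df.mul dx), pdx_mul df dx,
        pdy_mul dφ (dφ.mul (df.mul dy)), pdy_mul dφ (df.mul dy), pdy_mul df dy]
      refine (half_sq_mul_le (l := pLaplacian f z) (u := pdx φ z) (v := pdy φ z)
        (hM z (hs hz))).trans_eq ?_
      simp only [Pi.mul_apply, energyDensity, pLaplacian_eq]
      ring
    · have h0 : φ =ᶠ[nhds z] 0 := notMem_tsupport_iff_eventuallyEq.1 hz
      have hu0 : u =ᶠ[nhds z] 0 := by filter_upwards [h0] with w hw; simp [hu, hw]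
      have hv0 : v =ᶠ[nhds z] 0 := by filter_upwards [h0] with w hw; simp [hv, hw]
      rw [pdx_eq_fderiv (hu1.differentiable (by simp) z),
        pdy_eq_fderiv (hv1.differentiable (by simp) z), hu0.fderiv_eq, hv0.fderiv_eq]
      have := energyDensity_nonneg φ z
      simp only [h0.eq_of_nhds, Pi.zero_apply, fderiv_zero, zero_apply]
      norm_num
      positivity
  have hi12 : Integrable (fun z => fderiv ℝ u z 1 + fderiv ℝ v z Complex.I) := hi1.add hi2
  have hi123 : Integrable (fun z => fderiv ℝ u z 1 + fderiv ℝ v z Complex.I +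
      M * (φ z ^ 2 * |pLaplacian f z|)) := hi12.add (hiL.const_mul M)
  have hI := integral_mono (hiE.div_const 2) (hi123.add (hiφ.const_mul (2 * M ^ 2))) key
  simp only [Pi.add_apply] at hI
  rw [integral_add hi123 (hiφ.const_mul (2 * M ^ 2)), integral_add hi12 (hiL.const_mul M),
    integral_add hi1 hi2, integral_fderiv_apply_eq_zero (hu1.of_le (by simp)) huc,
    integral_fderiv_apply_eq_zero (hv1.of_le (by simp)) hvc, integral_const_mul,
    integral_const_mul, integral_div] at hI
  linarith

lemma energyDensity_comp_smul_sub {g : ℂ → ℝ} (hg : Differentiable ℝ g) (t : ℝ) (p z : ℂ) :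
    energyDensity (fun w => g (t • (w - p))) z = t ^ 2 * energyDensity g (t • (z - p)) := by
  have h : HasFDerivAt (fun w => g (t • (w - p)))
      ((fderiv ℝ g (t • (z - p))).comp (t • ContinuousLinearMap.id ℝ ℂ)) z :=
    (hg (t • (z - p))).hasFDerivAt.comp z (((hasFDerivAt_id z).sub_const p).const_smul t)
  unfold energyDensity
  rw [pdx_eq_fderiv h.differentiableAt, pdy_eq_fderiv h.differentiableAt, h.fderiv,
    pdx_eq_fderiv (hg _), pdy_eq_fderiv (hg _)]
  simp only [ContinuousLinearMap.comp_apply, smul_apply, ContinuousLinearMap.id_apply,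
    map_smul, smul_eq_mul]
  ring

/-- The Dirichlet energy in the plane is invariant under translation and dilation. -/
lemma integral_energyDensity_comp_smul_sub {g : ℂ → ℝ} (hg : Differentiable ℝ g) {t : ℝ}
    (ht : t ≠ 0) (p : ℂ) :
    ∫ z, energyDensity (fun w => g (t • (w - p))) z = ∫ z, energyDensity g z := by
  simp_rw [energyDensity_comp_smul_sub hg]
  rw [integral_const_mul, integral_sub_right_eq_self (fun z => energyDensity g (t • z)) p,
    Measure.integral_comp_smul volume (energyDensity g) t, Complex.finrank_real_complex,
    abs_of_nonneg (by positivity), smul_eq_mul]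
  field_simp

lemma energyDensity_sub_le {g h : ℂ → ℝ} (hg : Differentiable ℝ g) (hh : Differentiable ℝ h)
    (z : ℂ) : energyDensity (g - h) z ≤ 2 * energyDensity g z + 2 * energyDensity h z := by
  unfold energyDensity
  rw [pdx_eq_fderiv ((hg z).sub (hh z)), pdy_eq_fderiv ((hg z).sub (hh z)),
    pdx_eq_fderiv (hg z), pdy_eq_fderiv (hg z), pdx_eq_fderiv (hh z), pdy_eq_fderiv (hh z),
    fderiv_sub (hg z) (hh z)]
  simp only [sub_apply]
  nlinarith [sq_nonneg (fderiv ℝ g z 1 + fderiv ℝ h z 1),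
    sq_nonneg (fderiv ℝ g z Complex.I + fderiv ℝ h z Complex.I)]

/-- Cutoff functions away from the center of a disk, with uniformly bounded Dirichlet energy. -/
lemma exists_annular_cutoff (p : ℂ) {R : ℝ} (hR : 0 < R) :
    ∃ C : ℝ, ∀ t : ℝ, 1 ≤ t → ∃ φ : ℂ → ℝ, ContDiff ℝ (⊤ : ℕ∞) φ ∧ HasCompactSupport φ ∧
      tsupport φ ⊆ Metric.closedBall p R \ {p} ∧ (∀ z, |φ z| ≤ 1) ∧
      (∀ z ∉ Metric.ball p R \ {p}, φ z = 0) ∧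
      (∀ z ∈ Metric.ball p (R / 2) \ Metric.closedBall p (R / t), φ z = 1) ∧
      ∫ z, energyDensity φ z ≤ C := by
  let χ : ContDiffBump (0 : ℂ) := ⟨R / 2, R, by positivity, by linarith⟩
  have hχ : ContDiff ℝ (⊤ : ℕ∞) χ := χ.contDiff
  have hχd : Differentiable ℝ χ := hχ.differentiable (by simp)
  have hχ1 : ∀ w : ℂ, ‖w‖ ≤ R / 2 → χ w = 1 := fun w hw =>
    χ.one_of_mem_closedBall (by simpa using hw)
  have hχ0 : ∀ w : ℂ, R ≤ ‖w‖ → χ w = 0 := fun w hw => χ.zero_of_le_dist (by simpa using hw)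
  refine ⟨4 * ∫ z, energyDensity χ z, fun t ht => ?_⟩
  have ht0 : 0 < t := by linarith
  let ψ : ℝ → ℂ → ℝ := fun s z => χ (s • (z - p))
  have hψ : ∀ s, ContDiff ℝ (⊤ : ℕ∞) (ψ s) := fun s =>
    hχ.comp ((contDiff_id.sub contDiff_const).const_smul s)
  have hψd : ∀ s, Differentiable ℝ (ψ s) := fun s => (hψ s).differentiable (by simp)
  have hψ0 : ∀ s, 1 ≤ s → ∀ z, R ≤ s * ‖z - p‖ → ψ s z = 0 := fun s hs z hz =>
    hχ0 _ (by rwa [norm_smul, Real.norm_of_nonneg (by linarith)])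
  have hψ1 : ∀ s, 1 ≤ s → ∀ z, s * ‖z - p‖ ≤ R / 2 → ψ s z = 1 := fun s hs z hz =>
    hχ1 _ (by rwa [norm_smul, Real.norm_of_nonneg (by linarith)])
  have hle : ∀ z, ‖z - p‖ ≤ t * ‖z - p‖ := fun z => le_mul_of_one_le_left (norm_nonneg _) ht
  have hψc : ∀ s, 1 ≤ s → HasCompactSupport (ψ s) := fun s hs => by
    refine HasCompactSupport.intro (isCompact_closedBall p R) fun z hz => hψ0 s hs z ?_
    rw [mem_closedBall_iff_norm, not_le] at hz
    nlinarith [norm_nonneg (z - p)]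
  have hzero : ∀ z, R ≤ ‖z - p‖ → (ψ 1 - ψ t) z = 0 := fun z hz => by
    simp [hψ0 1 le_rfl z (by simpa using hz), hψ0 t ht z (hz.trans (hle z))]
  have hzero' : ∀ z, t * ‖z - p‖ ≤ R / 2 → (ψ 1 - ψ t) z = 0 := fun z hz => by
    simp [hψ1 1 le_rfl z (by simpa using (hle z).trans hz), hψ1 t ht z hz]
  have hi : ∀ s, 1 ≤ s → Integrable (energyDensity (ψ s)) := fun s hs =>
    integrable_energyDensity (hψ s) (hψc s hs)
  have hcs : HasCompactSupport (ψ 1 - ψ t) :=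
    HasCompactSupport.intro (isCompact_closedBall p R) fun z hz => hzero z (by
      rw [mem_closedBall_iff_norm, not_le] at hz
      exact hz.le)
  refine ⟨ψ 1 - ψ t, (hψ 1).sub (hψ t), hcs, ?_, fun z => ?_, fun z hz => ?_, fun z hz => ?_, ?_⟩
  · have hsub : tsupport (ψ 1 - ψ t) ⊆
        Metric.closedBall p R \ Metric.ball p (R / (2 * t)) := by
      refine closure_minimal (fun z hz => ⟨?_, fun hz' => hz (hzero' z ?_)⟩)
        (Metric.isClosed_closedBall.sdiff Metric.isOpen_ball)
      · by_contra hz'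
        rw [mem_closedBall_iff_norm, not_le] at hz'
        exact hz (hzero z hz'.le)
      · rw [mem_ball_iff_norm, lt_div_iff₀ (by positivity)] at hz'
        linarith
    refine hsub.trans (Set.sdiff_subset_sdiff_right ?_)
    rw [Set.singleton_subset_iff]
    exact Metric.mem_ball_self (by positivity)
  · simp only [Pi.sub_apply, ψ]
    rw [abs_le]
    constructor <;> linarith [χ.nonneg (x := (1 : ℝ) • (z - p)), χ.nonneg (x := t • (z - p)),
      χ.le_one (x := (1 : ℝ) • (z - p)), χ.le_one (x := t • (z - p))]
  · by_cases h : z ∈ Metric.ball p R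
    · have : z = p := by
        by_contra h'
        exact hz ⟨h, h'⟩
      exact hzero' z (by simpa [this] using (half_pos hR).le)
    · rw [mem_ball_iff_norm, not_lt] at h
      exact hzero z h
  · obtain ⟨h1, h2⟩ := hz
    rw [mem_ball_iff_norm] at h1
    rw [mem_closedBall_iff_norm, not_le, div_lt_iff₀ ht0] at h2
    rw [Pi.sub_apply, hψ1 1 le_rfl z (by linarith), hψ0 t ht z (by linarith), sub_zero]
  · calc ∫ z, energyDensity (ψ 1 - ψ t) z
        ≤ ∫ z, (2 * energyDensity (ψ 1) z + 2 * energyDensity (ψ t) z) :=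
          integral_mono (integrable_energyDensity ((hψ 1).sub (hψ t)) hcs)
            (((hi 1 le_rfl).const_mul 2).add ((hi t ht).const_mul 2))
            (energyDensity_sub_le (hψd 1) (hψd t))
      _ = 4 * ∫ z, energyDensity χ z := by
          rw [integral_add ((hi 1 le_rfl).const_mul 2) ((hi t ht).const_mul 2),
            integral_const_mul, integral_const_mul,
            integral_energyDensity_comp_smul_sub hχd one_ne_zero,
            integral_energyDensity_comp_smul_sub hχd ht0.ne']
          ring

/-- Let `U = B_R(p) ⊂ ℝ² ≅ ℂ` be an open disk centered at `p`, and let `f` be a bounded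
function that is smooth on an open neighborhood `V` of the closure of `U` minus `{p}`,
whose Laplacian `Δf` is Lebesgue integrable on `U ∖ {p}`.  Then `f` has finite Dirichlet
energy on `U ∖ {p}`: `∫_{U∖{p}} ((∂ₓf)² + (∂ᵧf)²) < ∞`. -/
theorem stmt6 (p : ℂ) (R : ℝ) (hR : 0 < R) (f : ℂ → ℝ)
    (V : Set ℂ) (hVopen : IsOpen V) (hUV : closure (Metric.ball p R) ⊆ V)
    (hf : ContDiffOn ℝ (⊤ : ℕ∞) f (V \ {p}))
    (hbd : ∃ M, ∀ z ∈ V \ {p}, |f z| ≤ M)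
    (hint : IntegrableOn (pLaplacian f) (Metric.ball p R \ {p}) volume) :
    IntegrableOn (fun z => pdx f z ^ 2 + pdy f z ^ 2) (Metric.ball p R \ {p}) volume := by
  have hW : IsOpen (V \ {p}) := hVopen.sdiff isClosed_singleton
  rw [closure_ball p hR.ne'] at hUV
  obtain ⟨M', hM'⟩ := hbd
  set M := max M' 0
  have hM : ∀ z ∈ V \ {p}, |f z| ≤ M := fun z hz => (hM' z hz).trans (le_max_left _ _)
  have hM0 : 0 ≤ M := le_max_right _ _
  obtain ⟨C, hC⟩ := exists_annular_cutoff p hR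
  change IntegrableOn (energyDensity f) _
  have hEc : ContinuousOn (energyDensity f) (V \ {p}) := (hf.energyDensity hW).continuousOn
  have hSm : MeasurableSet (Metric.ball p R \ {p}) :=
    measurableSet_ball.diff (measurableSet_singleton p)
  have hinner : IntegrableOn (energyDensity f) (Metric.ball p (R / 2) \ {p}) := by
    set A : ℕ → Set ℂ := fun n => (Metric.closedBall p (R / (n + 1)))ᶜ
    have hA : AECover (volume.restrict (Metric.ball p (R / 2) \ {p})) Filter.atTop A := by
      refine ⟨?_, fun n => measurableSet_closedBall.compl⟩
      filter_upwards [ae_restrict_mem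
        (measurableSet_ball.diff (measurableSet_singleton p))] with z hz
      have hd : 0 < dist z p := dist_pos.2 hz.2
      have hlim : Filter.Tendsto (fun n : ℕ => R / ((n : ℝ) + 1)) Filter.atTop (nhds 0) :=
        Filter.Tendsto.div_atTop tendsto_const_nhds
          (tendsto_natCast_atTop_atTop.atTop_add tendsto_const_nhds)
      filter_upwards [hlim.eventually_lt_const hd] with n hn
      simpa [A] using hn
    have hn : ∀ n : ℕ, IntegrableOn (energyDensity f) (A n)
          (volume.restrict (Metric.ball p (R / 2) \ {p})) ∧
        ∫ z in A n, energyDensity f z ∂(volume.restrict (Metric.ball p (R / 2) \ {p})) ≤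
          2 * M * (∫ z in Metric.ball p R \ {p}, |pLaplacian f z|) + 4 * M ^ 2 * C := by
      intro n
      obtain ⟨φ, hφ, hc, hs, hφ1, hφ0, hφA, hφC⟩ := hC (n + 1) (by simp)
      have hsW : tsupport φ ⊆ V \ {p} := hs.trans (Set.sdiff_subset_sdiff_left hUV)
      have hiE := integrable_sq_mul hW hφ.continuous hc hsW hEc
      have hiL := integrable_sq_mul hW hφ.continuous hc hsW
        (hf.pLaplacian hW).continuousOn.abs
      have hAm : MeasurableSet (A n ∩ (Metric.ball p (R / 2) \ {p})) :=
        measurableSet_closedBall.compl.inter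
          (measurableSet_ball.diff (measurableSet_singleton p))
      have heq : Set.EqOn (fun z => φ z ^ 2 * energyDensity f z) (energyDensity f)
          (A n ∩ (Metric.ball p (R / 2) \ {p})) := fun z hz => by
        simp [hφA z ⟨hz.2.1, hz.1⟩]
      rw [IntegrableOn, Measure.restrict_restrict measurableSet_closedBall.compl]
      refine ⟨hiE.integrableOn.congr_fun heq hAm, ?_⟩
      have hlap : ∫ z, φ z ^ 2 * |pLaplacian f z| ≤
          ∫ z in Metric.ball p R \ {p}, |pLaplacian f z| := by
        rw [← setIntegral_eq_integral_of_forall_compl_eq_zero (s := Metric.ball p R \ {p})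
          fun z hz => by simp [hφ0 z hz]]
        refine integral_mono hiL.integrableOn hint.abs fun z => ?_
        exact mul_le_of_le_one_left (abs_nonneg _) ((sq_le_one_iff_abs_le_one _).2 (hφ1 z))
      calc ∫ z in A n ∩ (Metric.ball p (R / 2) \ {p}), energyDensity f z
          = ∫ z in A n ∩ (Metric.ball p (R / 2) \ {p}), φ z ^ 2 * energyDensity f z :=
            (setIntegral_congr_fun hAm heq).symm
        _ ≤ ∫ z, φ z ^ 2 * energyDensity f z :=
            setIntegral_le_integral hiE (Filter.Eventually.of_forall fun z =>
              mul_nonneg (sq_nonneg _) (energyDensity_nonneg f z))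
        _ ≤ 2 * M * (∫ z, φ z ^ 2 * |pLaplacian f z|) + 4 * M ^ 2 * ∫ z, energyDensity φ z :=
            integral_sq_mul_energyDensity_le hW hf hM hφ hc hsW
        _ ≤ _ := by gcongr
    exact hA.integrable_of_integral_bounded_of_nonneg_ae _ (fun n => (hn n).1)
      (Filter.Eventually.of_forall (energyDensity_nonneg f))
      (Filter.Eventually.of_forall fun n => (hn n).2)
  have houter : IntegrableOn (energyDensity f)
      (Metric.closedBall p R \ Metric.ball p (R / 2)) := by
    refine ContinuousOn.integrableOn_compact
      ((isCompact_closedBall p R).diff Metric.isOpen_ball) (hEc.mono fun z hz => ⟨hUV hz.1, ?_⟩)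
    rintro rfl
    exact hz.2 (Metric.mem_ball_self (by positivity))
  refine (hinner.union houter).mono_set fun z hz => ?_
  by_cases h : z ∈ Metric.ball p (R / 2)
  · exact Or.inl ⟨h, hz.2⟩
  · exact Or.inr ⟨Metric.ball_subset_closedBall hz.1, h⟩
end

section
/- Let U ⊂ ℝ² be an open disk centered at a point p, and let f be a bounded function that is smooth on an open neighborhood of the closure of U minus {p}, whose Laplacian Δf is Lebesgue integrable on U∖{p}. Then the flux of f through small circles around p vanishes asymptotically along a subsequence: liminf_{ε→0} ε ∫₀^{2π} |∂_r f(p + ε e^{iθ})| dθ = 0, where ∂_r denotes the radial derivative centered at p. In particular liminf_{ε→0} |∫_{∂B_ε(p)} ⋆df| = 0, where ⋆ is the Euclidean Hodge star on 1-forms of ℝ². -/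
open MeasureTheory

/-- The radial derivative `∂_r f` centered at `p`, evaluated at the point
`p + ρ e^{iθ}`. -/
noncomputable def pdr (f : ℂ → ℝ) (p : ℂ) (ρ θ : ℝ) : ℝ :=
  deriv (fun s : ℝ => f (p + (s : ℂ) * Complex.exp ((θ : ℂ) * Complex.I))) ρ

open Set Filter Topology

/-- Differentiation under the integral sign over a compact interval, for jointly continuous data. -/
lemma hasDerivAt_intervalIntegral_of_continuousOn {F F' : ℝ → ℝ → ℝ} {T a b t : ℝ}
    (hF : ContinuousOn (fun x : ℝ × ℝ => F x.1 x.2) (Iio T ×ˢ univ))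
    (hF' : ContinuousOn (fun x : ℝ × ℝ => F' x.1 x.2) (Iio T ×ˢ univ))
    (hd : ∀ s < T, ∀ θ, HasDerivAt (fun s => F s θ) (F' s θ) s) (ht : t < T) :
    HasDerivAt (fun s => ∫ θ in a..b, F s θ) (∫ θ in a..b, F' t θ) t := by
  have hslice : ∀ {G : ℝ → ℝ → ℝ},
      ContinuousOn (fun x : ℝ × ℝ => G x.1 x.2) (Iio T ×ˢ univ) → ∀ s < T, Continuous (G s) := by
    intro G hG s hs
    exact hG.comp_continuous (f := fun θ : ℝ => (s, θ)) (by fun_prop) fun θ => ⟨hs, mem_univ _⟩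
  set S := Icc (t - 1) ((t + T) / 2) with hS
  have hST : ∀ s ∈ S, s < T := fun s hs => by linarith [hs.2]
  obtain ⟨C, hC⟩ := (isCompact_Icc.prod (isCompact_uIcc (a := a) (b := b))).exists_bound_of_continuousOn
    (hF'.mono (prod_mono (show S ⊆ Iio T from hST) (subset_univ (uIcc a b))))
  refine (intervalIntegral.hasDerivAt_integral_of_dominated_loc_of_deriv_le (s := S)
    (bound := fun _ => C) (Icc_mem_nhds (by linarith) (by linarith)) ?_
    ((hslice hF t ht).intervalIntegrable _ _) (hslice hF' t ht).aestronglyMeasurable ?_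
    intervalIntegrable_const ?_).2
  · filter_upwards [Iio_mem_nhds ht] with s hs using (hslice hF s hs).aestronglyMeasurable
  · exact .of_forall fun θ hθ s hs => hC (s, θ) ⟨hs, uIoc_subset_uIcc hθ⟩
  · exact .of_forall fun θ _ s hs => hd s (hST s hs) θ

/-- A lower bound for the `L²` norm of a function on an interval through its `L¹` norm. -/
lemma sq_integral_abs_div_le {u : ℝ → ℝ} {c l : ℝ} (hl : 0 < l) (hu : Continuous u) (hc : 0 ≤ c)
    (h : c ≤ ∫ θ in (0 : ℝ)..l, |u θ|) : c ^ 2 / l ≤ ∫ θ in (0 : ℝ)..l, u θ ^ 2 := by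
  have h1 : ∫ θ in (0 : ℝ)..l, (2 * (c / l) * |u θ| - (c / l) ^ 2) ≤ ∫ θ in (0 : ℝ)..l, u θ ^ 2 := by
    refine intervalIntegral.integral_mono_on hl.le (Continuous.intervalIntegrable (by fun_prop) _ _)
      (Continuous.intervalIntegrable (by fun_prop) _ _) fun θ _ => ?_
    nlinarith [sq_nonneg (|u θ| - c / l), sq_abs (u θ)]
  rw [intervalIntegral.integral_sub (Continuous.intervalIntegrable (by fun_prop) _ _)
    (by simp), intervalIntegral.integral_const_mul] at h1
  simp only [intervalIntegral.integral_const, smul_eq_mul, sub_zero] at h1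
  have h2 : 2 * (c / l) * c ≤ 2 * (c / l) * ∫ θ in (0 : ℝ)..l, |u θ| := by gcongr
  have h3 : c ^ 2 / l = 2 * (c / l) * c - l * (c / l) ^ 2 := by field_simp; ring
  linarith

/-- A bounded function on a half-cylinder whose Laplacian is integrable has arbitrarily small
`L¹` norms of the axial derivative on circles going to infinity. -/
lemma frequently_integral_abs_lt_of_bounded {h ht hθ htt hθθ : ℝ → ℝ → ℝ} {T l M : ℝ} (hl : 0 < l)
    (ch : ContinuousOn (fun x : ℝ × ℝ => h x.1 x.2) (Iio T ×ˢ univ))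
    (cht : ContinuousOn (fun x : ℝ × ℝ => ht x.1 x.2) (Iio T ×ˢ univ))
    (chθ : ContinuousOn (fun x : ℝ × ℝ => hθ x.1 x.2) (Iio T ×ˢ univ))
    (chtt : ContinuousOn (fun x : ℝ × ℝ => htt x.1 x.2) (Iio T ×ˢ univ))
    (chθθ : ContinuousOn (fun x : ℝ × ℝ => hθθ x.1 x.2) (Iio T ×ˢ univ))
    (dt : ∀ t < T, ∀ θ, HasDerivAt (fun s => h s θ) (ht t θ) t)
    (dtt : ∀ t < T, ∀ θ, HasDerivAt (fun s => ht s θ) (htt t θ) t)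
    (dθ : ∀ t < T, ∀ θ, HasDerivAt (h t) (hθ t θ) θ)
    (dθθ : ∀ t < T, ∀ θ, HasDerivAt (hθ t) (hθθ t θ) θ)
    (per : ∀ t < T, h t l = h t 0) (perθ : ∀ t < T, hθ t l = hθ t 0)
    (bd : ∀ t < T, ∀ θ, |h t θ| ≤ M)
    (int : IntegrableOn (fun t => ∫ θ in (0 : ℝ)..l, |htt t θ + hθθ t θ|) (Iio T))
    {c : ℝ} (hc : 0 < c) : ∃ᶠ t in atBot, ∫ θ in (0 : ℝ)..l, |ht t θ| < c := by
  intro hcon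
  have hslice : ∀ {G : ℝ → ℝ → ℝ},
      ContinuousOn (fun x : ℝ × ℝ => G x.1 x.2) (Iio T ×ˢ univ) → ∀ s < T, Continuous (G s) := by
    intro G hG s hs
    exact hG.comp_continuous (f := fun θ : ℝ => (s, θ)) (by fun_prop) fun θ => ⟨hs, mem_univ _⟩
  set q : ℝ → ℝ := fun t => ∫ θ in (0 : ℝ)..l, |htt t θ + hθθ t θ| with hq
  set k := c ^ 2 / l with hk
  have hkpos : 0 < k := by positivity
  set P : ℝ → ℝ := fun t => ∫ θ in (0 : ℝ)..l, h t θ * ht t θ with hP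
  set P' : ℝ → ℝ := fun t => ∫ θ in (0 : ℝ)..l, (ht t θ * ht t θ + h t θ * htt t θ) with hP'
  set A : ℝ → ℝ := fun t => ∫ θ in (0 : ℝ)..l, h t θ * h t θ with hA
  have dA : ∀ t < T, HasDerivAt A (2 * P t) t := by
    intro t htT
    convert hasDerivAt_intervalIntegral_of_continuousOn (T := T) (a := 0) (b := l)
      (F := fun t θ => h t θ * h t θ) (F' := fun t θ => 2 * (h t θ * ht t θ))
      (ch.mul ch) (continuousOn_const.mul (ch.mul cht)) ?_ htT using 1
    · rw [intervalIntegral.integral_const_mul]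
    · intro s hs θ
      exact ((dt s hs θ).mul (dt s hs θ)).congr_deriv (by ring)
  have dP : ∀ t < T, HasDerivAt P (P' t) t := fun t htT =>
    hasDerivAt_intervalIntegral_of_continuousOn (T := T)
      (F := fun t θ => h t θ * ht t θ) (F' := fun t θ => ht t θ * ht t θ + h t θ * htt t θ)
      (ch.mul cht) ((cht.mul cht).add (ch.mul chtt))
      (fun s hs θ => (dt s hs θ).mul (dtt s hs θ)) htT
  have key : ∀ t < T, (∫ θ in (0 : ℝ)..l, ht t θ ^ 2) - M * q t ≤ P' t := by
    intro t htT
    have c0 := hslice ch t htT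
    have c1 := hslice cht t htT
    have c2 := hslice chθ t htT
    have c3 := hslice chtt t htT
    have c4 := hslice chθθ t htT
    have ibp := intervalIntegral.integral_mul_deriv_eq_deriv_mul (a := 0) (b := l)
      (u := h t) (v := hθ t) (u' := hθ t) (v' := hθθ t) (fun θ _ => dθ t htT θ)
      (fun θ _ => dθθ t htT θ) (c2.intervalIntegrable _ _) (c4.intervalIntegrable _ _)
    rw [per t htT, perθ t htT, sub_self, zero_sub] at ibp
    have e1 : P' t = (∫ θ in (0 : ℝ)..l, (ht t θ ^ 2 + h t θ * (htt t θ + hθθ t θ)))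
        - ∫ θ in (0 : ℝ)..l, h t θ * hθθ t θ := by
      rw [← intervalIntegral.integral_sub (Continuous.intervalIntegrable (by fun_prop) _ _)
        (Continuous.intervalIntegrable (by fun_prop) _ _)]
      refine intervalIntegral.integral_congr fun θ _ => ?_
      ring
    have e2 : 0 ≤ ∫ θ in (0 : ℝ)..l, hθ t θ * hθ t θ :=
      intervalIntegral.integral_nonneg hl.le fun θ _ => mul_self_nonneg _
    have e3 : (∫ θ in (0 : ℝ)..l, ht t θ ^ 2) - M * q t
        ≤ ∫ θ in (0 : ℝ)..l, (ht t θ ^ 2 + h t θ * (htt t θ + hθθ t θ)) := by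
      rw [hq, ← intervalIntegral.integral_const_mul,
        ← intervalIntegral.integral_sub (Continuous.intervalIntegrable (by fun_prop) _ _)
        (Continuous.intervalIntegrable (by fun_prop) _ _)]
      refine intervalIntegral.integral_mono_on hl.le
        (Continuous.intervalIntegrable (by fun_prop) _ _)
        (Continuous.intervalIntegrable (by fun_prop) _ _) fun θ _ => ?_
      have : |h t θ * (htt t θ + hθθ t θ)| ≤ M * |htt t θ + hθθ t θ| := by
        rw [abs_mul]
        exact mul_le_mul_of_nonneg_right (bd t htT θ) (abs_nonneg _)
      linarith [neg_abs_le (h t θ * (htt t θ + hθθ t θ))]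
    linarith
  obtain ⟨t₀, ht₀⟩ := eventually_atBot.1 (hcon.and (eventually_lt_atBot T))
  have ht₀T : t₀ < T := (ht₀ t₀ le_rfl).2
  have hM : 0 ≤ M := (abs_nonneg _).trans (bd t₀ ht₀T 0)
  have hP'k : ∀ t ≤ t₀, k - M * q t ≤ P' t := by
    intro t h'
    have := sq_integral_abs_div_le hl (hslice cht t (ht₀ t h').2) hc.le (not_lt.1 (ht₀ t h').1)
    linarith [key t (ht₀ t h').2]
  set K := ∫ t in Iio T, q t with hK
  have hq0 : ∀ t, 0 ≤ q t := fun t =>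
    intervalIntegral.integral_nonneg hl.le fun θ _ => abs_nonneg _
  have hPle : ∀ t ≤ t₀, P t ≤ P t₀ + M * K - k * (t₀ - t) := by
    intro t h'
    have hqi : IntegrableOn q (Icc t t₀) := int.mono_set fun s hs => hs.2.trans_lt ht₀T
    have := intervalIntegral.integral_le_sub_of_hasDeriv_right_of_le (g := P) (g' := P')
      (φ := fun s => k - M * q s) h'
      (fun s hs => (dP s (hs.2.trans_lt ht₀T)).continuousAt.continuousWithinAt)
      (fun s hs => (dP s (hs.2.trans ht₀T)).hasDerivWithinAt)
      ((integrableOn_const (by simp)).sub (hqi.const_mul M))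
      (fun s hs => hP'k s hs.2.le)
    have hqi' : IntervalIntegrable q volume t t₀ :=
      (intervalIntegrable_iff_integrableOn_Icc_of_le h').2 hqi
    rw [intervalIntegral.integral_sub (by simp) (hqi'.const_mul M),
      intervalIntegral.integral_const_mul] at this
    simp only [intervalIntegral.integral_const, smul_eq_mul] at this
    have hqK : ∫ s in t..t₀, q s ≤ K := by
      rw [intervalIntegral.integral_of_le h']
      exact setIntegral_mono_set int (.of_forall hq0)
        (LE.le.eventuallyLE fun s hs => hs.2.trans_lt ht₀T)
    nlinarith [mul_le_mul_of_nonneg_left hqK hM]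
  obtain ⟨t₁, ht₁, ht₁'⟩ : ∃ t₁ ≤ t₀, ∀ t ≤ t₁, P t ≤ -1 := by
    refine ⟨t₀ - (|P t₀ + M * K| + 1) / k, by have : 0 ≤ (|P t₀ + M * K| + 1) / k := by positivity
                                              linarith, fun t h' => ?_⟩
    have h2 := hPle t (h'.trans (by
      have : 0 ≤ (|P t₀ + M * K| + 1) / k := by positivity
      linarith))
    have h3 : k * ((|P t₀ + M * K| + 1) / k) ≤ k * (t₀ - t) := by
      apply mul_le_mul_of_nonneg_left _ hkpos.le
      linarith
    rw [mul_div_cancel₀ _ hkpos.ne'] at h3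
    linarith [le_abs_self (P t₀ + M * K)]
  have hAle : ∀ t < T, A t ≤ l * M ^ 2 := by
    intro t htT
    have c0 := hslice ch t htT
    have : A t ≤ ∫ θ in (0 : ℝ)..l, M ^ 2 := by
      refine intervalIntegral.integral_mono_on hl.le
        (Continuous.intervalIntegrable (by fun_prop) _ _) (by simp) fun θ _ => ?_
      rw [← sq]
      exact sq_le_sq' (by linarith [neg_abs_le (h t θ), bd t htT θ])
        ((le_abs_self _).trans (bd t htT θ))
    simpa using this
  have hA0 : 0 ≤ A t₁ := intervalIntegral.integral_nonneg hl.le fun θ _ => mul_self_nonneg _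
  set t := t₁ - (l * M ^ 2 + 1) with htdef
  have htt₁ : t ≤ t₁ := by have : 0 ≤ l * M ^ 2 := by positivity
                           linarith
  have hfin := intervalIntegral.integral_le_sub_of_hasDeriv_right_of_le (g := fun s => -A s)
      (g' := fun s => -(2 * P s)) (φ := fun s => 2) htt₁
      (fun s hs => (dA s (by linarith [hs.2])).neg.continuousAt.continuousWithinAt)
      (fun s hs => (dA s (by linarith [hs.2])).neg.hasDerivWithinAt)
      (integrableOn_const (by simp))
      (fun s hs => by linarith [ht₁' s hs.2.le])
  simp only [intervalIntegral.integral_const, smul_eq_mul] at hfin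
  have := hAle t (by linarith)
  have : 0 ≤ l * M ^ 2 := by positivity
  linarith

/-- The second derivative along a line through a point of an open set of `C²` regularity. -/
lemma iteratedDeriv_two_comp_line {f : ℂ → ℝ} {W : Set ℂ} (hW : IsOpen W) (hf : ContDiffOn ℝ 2 f W)
    (a v : ℂ) (x : ℝ) (hx : a + x * v ∈ W) :
    iteratedDeriv 2 (fun s : ℝ => f (a + s * v)) x =
      fderiv ℝ (fderiv ℝ f) (a + x * v) v v := by
  have hline : ∀ s : ℝ, HasDerivAt (fun s : ℝ => a + s * v) v s := fun s => by
    simpa using ((Complex.ofRealCLM.hasDerivAt (x := s)).mul_const v).const_add a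
  have hD : DifferentiableOn ℝ (fderiv ℝ f) W :=
    (hf.fderiv_of_isOpen (m := 1) hW (by norm_num)).differentiableOn one_ne_zero
  have h1 : deriv (fun s : ℝ => f (a + s * v)) =ᶠ[𝓝 x] fun s => fderiv ℝ f (a + s * v) v := by
    filter_upwards [(hline x).continuousAt.preimage_mem_nhds (hW.mem_nhds hx)] with s hs
    exact (((hf.differentiableOn two_ne_zero).differentiableAt
      (hW.mem_nhds hs)).hasFDerivAt.comp_hasDerivAt s (hline s)).deriv
  rw [iteratedDeriv_succ, iteratedDeriv_one, h1.deriv_eq]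
  have h2 : HasDerivAt (fun s : ℝ => fderiv ℝ f (a + s * v))
      (fderiv ℝ (fderiv ℝ f) (a + x * v) v) x :=
    (hD.differentiableAt (hW.mem_nhds hx)).hasFDerivAt.comp_hasDerivAt x (hline x)
  simpa using (h2.clm_apply (hasDerivAt_const x v)).deriv

/-- `pLaplacian` in terms of the second Fréchet derivative. -/
lemma pLaplacian_eq_fderiv {f : ℂ → ℝ} {W : Set ℂ} (hW : IsOpen W) (hf : ContDiffOn ℝ 2 f W)
    {z : ℂ} (hz : z ∈ W) :
    pLaplacian f z = fderiv ℝ (fderiv ℝ f) z 1 1 +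
      fderiv ℝ (fderiv ℝ f) z Complex.I Complex.I := by
  have h1 := iteratedDeriv_two_comp_line hW hf (z.im * Complex.I) 1 z.re
    (by simpa [add_comm] using hz)
  have h2 := iteratedDeriv_two_comp_line hW hf z.re Complex.I z.im (by simpa using hz)
  rw [Complex.re_add_im] at h2
  rw [mul_one, add_comm, Complex.re_add_im] at h1
  rw [← h1, ← h2, pLaplacian]
  simp only [mul_one, add_comm]

/-- The trace of a symmetric bilinear form on `ℂ` scales by `|e|²` under multiplication by `e`. -/
lemma symm_bilin_mul_add (B : ℂ →L[ℝ] ℂ →L[ℝ] ℝ) (hB : ∀ v w, B v w = B w v) (e : ℂ) :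
    B e e + B (e * Complex.I) (e * Complex.I) =
      Complex.normSq e * (B 1 1 + B Complex.I Complex.I) := by
  have h1 : e = e.re • (1 : ℂ) + e.im • Complex.I := by simp
  have h2 : e * Complex.I = e.re • Complex.I - e.im • (1 : ℂ) := by
    apply Complex.ext <;> simp
  rw [h2, h1]
  simp only [map_add, map_sub, map_smul, add_apply, sub_apply, smul_apply, smul_eq_mul,
    hB Complex.I 1, Complex.normSq_apply]
  simp
  ring

/-- Integrability transfers through the logarithmic polar coordinates `(t, θ) ↦ p + exp (t + iθ)`. -/
lemma integrableOn_integral_abs_comp_exp {g : ℂ → ℝ} {p : ℂ} {R : ℝ} (hR : 0 < R)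
    (hg : IntegrableOn g (Metric.ball p R \ {p})) :
    IntegrableOn (fun t : ℝ => ∫ θ in (0 : ℝ)..(2 * Real.pi),
      |Complex.normSq (Complex.exp (t + θ * Complex.I)) *
        g (p + Complex.exp (t + θ * Complex.I))|) (Iio (Real.log R)) := by
  set S : Set ℂ := Iio (Real.log R) ×ℂ Ioc 0 (2 * Real.pi) with hS
  have hSm : MeasurableSet S :=
    (Complex.measurable_re measurableSet_Iio).inter (Complex.measurable_im measurableSet_Ioc)
  have hinj : InjOn (fun w => p + Complex.exp w) S := by
    intro w hw w' hw' h
    obtain ⟨n, hn⟩ := Complex.exp_eq_exp_iff_exists_int.1 (add_left_cancel h)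
    have him := congrArg Complex.im hn
    have hn0 : n = 0 := by
      simp at him
      have h1 := hw.2
      have h2 := hw'.2
      simp only [mem_preimage, mem_Ioc] at h1 h2
      have hpi := Real.pi_pos
      have l1 : (n : ℝ) < 1 := by
        by_contra! hh
        nlinarith
      have l2 : (-1 : ℝ) < n := by
        by_contra! hh
        nlinarith
      have l1' : n < 1 := by exact_mod_cast l1
      have l2' : -1 < n := by exact_mod_cast l2
      lia
    simpa [hn0] using hn
  have hsub : (fun w => p + Complex.exp w) '' S ⊆ Metric.ball p R \ {p} := by
    rintro _ ⟨w, hw, rfl⟩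
    refine ⟨?_, by simp [Complex.exp_ne_zero]⟩
    simpa [Complex.norm_exp, Real.lt_log_iff_exp_lt hR] using hw.1
  have hder : ∀ w ∈ S, HasFDerivWithinAt (fun w => p + Complex.exp w)
      ((Complex.exp w • (1 : ℂ →L[ℂ] ℂ)).restrictScalars ℝ) S w := by
    intro w _
    have h1 := ((Complex.hasDerivAt_exp w).const_add p).hasFDerivAt.restrictScalars ℝ
    refine (h1.congr_fderiv ?_).hasFDerivWithinAt
    ext
    simp [mul_comm]
  have h1 := (integrableOn_image_iff_integrableOn_abs_det_fderiv_smul volume hSm hder hinj g).1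
    (hg.mono_set hsub)
  have hdet : ∀ w : ℂ, ((Complex.exp w • (1 : ℂ →L[ℂ] ℂ)).restrictScalars ℝ).det =
      Complex.normSq (Complex.exp w) := by
    intro w
    change LinearMap.det ((Complex.exp w • (1 : ℂ →ₗ[ℂ] ℂ)).restrictScalars ℝ) = _
    rw [LinearMap.det_restrictScalars]
    simp [Algebra.norm_complex_eq]
  simp only [hdet, abs_of_nonneg (Complex.normSq_nonneg _), smul_eq_mul] at h1
  rw [← (Complex.volume_preserving_equiv_real_prod.symm _).integrableOn_comp_preimage
    (MeasurableEquiv.measurableEmbedding _)] at h1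
  have hpre : Complex.measurableEquivRealProd.symm ⁻¹' S =
      Iio (Real.log R) ×ˢ Ioc 0 (2 * Real.pi) := by
    ext x
    simp [hS, Complex.mem_reProdIm, Complex.measurableEquivRealProd]
  rw [hpre, IntegrableOn, Measure.volume_eq_prod, ← Measure.prod_restrict] at h1
  have h2 := h1.norm.integral_prod_left
  refine h2.congr (.of_forall fun t => ?_)
  simp only [intervalIntegral.integral_of_le Real.two_pi_pos.le]
  refine integral_congr_ae (.of_forall fun θ => ?_)
  have : (Complex.measurableEquivRealProd.symm (t, θ)) = t + θ * Complex.I := by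
    exact Complex.mk_eq_add_mul_I t θ
  simp [this]

/-- A nonnegative quantity that is frequently smaller than any positive constant has zero `liminf`. -/
lemma liminf_eq_zero_of_frequently_lt {α : Type*} {l : Filter α} {u : α → ℝ}
    (h0 : ∀ᶠ x in l, 0 ≤ u x) (h : ∀ c > 0, ∃ᶠ x in l, u x < c) : liminf u l = 0 := by
  have hle : ∀ a ∈ {a | ∀ᶠ x in l, a ≤ u x}, a ≤ 0 := by
    intro a ha
    by_contra! hpos
    obtain ⟨x, hx, hx'⟩ := ((h a hpos).and_eventually ha).exists
    exact absurd hx (not_lt.2 hx')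
  rw [liminf_eq]
  exact le_antisymm (csSup_le ⟨0, h0⟩ hle) (le_csSup ⟨0, hle⟩ h0)

/-- In logarithmic polar coordinates, a bounded function with integrable Laplacian has arbitrarily
small radial flux. -/
lemma frequently_radial_flux_lt {p : ℂ} {R M : ℝ} (hR : 0 < R) {f : ℂ → ℝ} {W : Set ℂ}
    (hW : IsOpen W) (hUW : Metric.ball p R \ {p} ⊆ W) (hf : ContDiffOn ℝ 2 f W)
    (hbd : ∀ z ∈ W, |f z| ≤ M) (hint : IntegrableOn (pLaplacian f) (Metric.ball p R \ {p}))
    {c : ℝ} (hc : 0 < c) :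
    ∃ᶠ ε in 𝓝[>] (0 : ℝ), ε * ∫ θ in (0 : ℝ)..(2 * Real.pi), |pdr f p ε θ| < c := by
  set E : ℝ → ℝ → ℂ := fun t θ => Complex.exp (t + θ * Complex.I) with hE
  set T := Real.log R with hT
  have hnorm : ∀ t θ, ‖E t θ‖ = Real.exp t := fun t θ => by simp [hE, Complex.norm_exp]
  have hmem : ∀ t < T, ∀ θ, p + E t θ ∈ W := fun t ht θ => by
    refine hUW ⟨?_, by simp [hE, Complex.exp_ne_zero]⟩
    simpa [hnorm] using (Real.lt_log_iff_exp_lt hR).1 ht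
  have hEt : ∀ t θ, HasDerivAt (fun s => E s θ) (E t θ) t := fun t θ => by
    have h1 : HasDerivAt (fun s : ℝ => (s : ℂ) + θ * Complex.I) 1 t :=
      (Complex.ofRealCLM.hasDerivAt (x := t)).add_const _
    simpa using h1.cexp
  have hEθ : ∀ t θ, HasDerivAt (E t) (E t θ * Complex.I) θ := fun t θ => by
    have h1 : HasDerivAt (fun s : ℝ => (t : ℂ) + s * Complex.I) Complex.I θ := by
      simpa using ((Complex.ofRealCLM.hasDerivAt (x := θ)).mul_const Complex.I).const_add (t : ℂ)
    exact h1.cexp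
  have hEper : ∀ t, E t (2 * Real.pi) = E t 0 := fun t => by
    have := Complex.exp_periodic (t : ℂ)
    simpa [hE] using this
  have cE : Continuous fun x : ℝ × ℝ => E x.1 x.2 := by fun_prop
  have hEe : ∀ t θ : ℝ, E t θ = Real.exp t * Complex.exp (θ * Complex.I) := fun t θ => by
    simp [hE, Complex.exp_add]
  have hintE : IntegrableOn (fun t => ∫ θ in (0 : ℝ)..(2 * Real.pi),
      |Complex.normSq (E t θ) * pLaplacian f (p + E t θ)|) (Iio T) :=
    integrableOn_integral_abs_comp_exp hR hint
  clear_value E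
  have hD1 : ∀ z ∈ W, HasFDerivAt f (fderiv ℝ f z) z := fun z hz =>
    ((hf.differentiableOn two_ne_zero).differentiableAt (hW.mem_nhds hz)).hasFDerivAt
  have hDf : ContDiffOn ℝ 1 (fderiv ℝ f) W := hf.fderiv_of_isOpen hW (by norm_num)
  have hD2 : ∀ z ∈ W, HasFDerivAt (fderiv ℝ f) (fderiv ℝ (fderiv ℝ f) z) z := fun z hz =>
    ((hDf.differentiableOn one_ne_zero).differentiableAt (hW.mem_nhds hz)).hasFDerivAt
  have hDDf : ContinuousOn (fderiv ℝ (fderiv ℝ f)) W :=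
    hDf.continuousOn_fderiv_of_isOpen hW le_rfl
  have hsymm : ∀ z ∈ W, ∀ v w, fderiv ℝ (fderiv ℝ f) z v w = fderiv ℝ (fderiv ℝ f) z w v :=
    fun z hz => ((hf z hz).contDiffAt (hW.mem_nhds hz)).isSymmSndFDerivAt (by simp)
  have cZ : ContinuousOn (fun x : ℝ × ℝ => p + E x.1 x.2) (Iio T ×ˢ univ) := by fun_prop
  have mZ : MapsTo (fun x : ℝ × ℝ => p + E x.1 x.2) (Iio T ×ˢ univ) W :=
    fun x hx => hmem x.1 hx.1 x.2
  have hlap : ∀ t < T, ∀ θ,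
      (fderiv ℝ (fderiv ℝ f) (p + E t θ) (E t θ) (E t θ) + fderiv ℝ f (p + E t θ) (E t θ)) +
      (fderiv ℝ (fderiv ℝ f) (p + E t θ) (E t θ * Complex.I) (E t θ * Complex.I) +
        fderiv ℝ f (p + E t θ) (E t θ * Complex.I * Complex.I)) =
      Complex.normSq (E t θ) * pLaplacian f (p + E t θ) := by
    intro t ht θ
    rw [pLaplacian_eq_fderiv hW hf (hmem t ht θ),
      ← symm_bilin_mul_add _ (hsymm _ (hmem t ht θ)) (E t θ)]
    rw [mul_assoc, Complex.I_mul_I, mul_neg_one, map_neg]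
    ring
  have cEI : Continuous fun x : ℝ × ℝ => E x.1 x.2 * Complex.I := by fun_prop
  generalize fderiv ℝ (fderiv ℝ f) = D₂ at *
  generalize fderiv ℝ f = D₁ at *
  have c0 : ContinuousOn (fun x : ℝ × ℝ => f (p + E x.1 x.2)) (Iio T ×ˢ univ) :=
    hf.continuousOn.comp cZ mZ
  have c1 : ContinuousOn (fun x : ℝ × ℝ => D₁ (p + E x.1 x.2)) (Iio T ×ˢ univ) :=
    hDf.continuousOn.comp cZ mZ
  have c2 : ContinuousOn (fun x : ℝ × ℝ => D₂ (p + E x.1 x.2)) (Iio T ×ˢ univ) :=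
    hDDf.comp cZ mZ
  have dt : ∀ t < T, ∀ θ, HasDerivAt (fun s => f (p + E s θ)) (D₁ (p + E t θ) (E t θ)) t :=
    fun t ht θ => (hD1 _ (hmem t ht θ)).comp_hasDerivAt t ((hEt t θ).const_add p)
  have dθ : ∀ t < T, ∀ θ, HasDerivAt (fun s => f (p + E t s))
      (D₁ (p + E t θ) (E t θ * Complex.I)) θ :=
    fun t ht θ => (hD1 _ (hmem t ht θ)).comp_hasDerivAt θ ((hEθ t θ).const_add p)
  have dtt : ∀ t < T, ∀ θ, HasDerivAt (fun s => D₁ (p + E s θ) (E s θ))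
      (D₂ (p + E t θ) (E t θ) (E t θ) + D₁ (p + E t θ) (E t θ)) t := fun t ht θ => by
    have h1 : HasDerivAt (fun s => D₁ (p + E s θ)) (D₂ (p + E t θ) (E t θ)) t :=
      (hD2 _ (hmem t ht θ)).comp_hasDerivAt t ((hEt t θ).const_add p)
    exact h1.clm_apply (hEt t θ)
  have dθθ : ∀ t < T, ∀ θ, HasDerivAt (fun s => D₁ (p + E t s) (E t s * Complex.I))
      (D₂ (p + E t θ) (E t θ * Complex.I) (E t θ * Complex.I) +
        D₁ (p + E t θ) (E t θ * Complex.I * Complex.I)) θ := fun t ht θ => by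
    have h1 : HasDerivAt (fun s => D₁ (p + E t s)) (D₂ (p + E t θ) (E t θ * Complex.I)) θ :=
      (hD2 _ (hmem t ht θ)).comp_hasDerivAt θ ((hEθ t θ).const_add p)
    exact h1.clm_apply ((hEθ t θ).mul_const Complex.I)
  have main := frequently_integral_abs_lt_of_bounded Real.two_pi_pos c0
    (c1.clm_apply cE.continuousOn) (c1.clm_apply cEI.continuousOn)
    (((c2.clm_apply cE.continuousOn).clm_apply cE.continuousOn).add
      (c1.clm_apply cE.continuousOn))
    (((c2.clm_apply cEI.continuousOn).clm_apply cEI.continuousOn).add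
      (c1.clm_apply (cEI.mul_const Complex.I).continuousOn)) dt dtt dθ dθθ
    (fun t ht => by simp only [hEper]) (fun t ht => by simp only [hEper])
    (fun t ht θ => hbd _ (hmem t ht θ))
    (hintE.congr_fun
      (fun t ht => intervalIntegral.integral_congr fun θ _ => by simp only [hlap t ht θ])
      measurableSet_Iio) hc
  refine Real.tendsto_exp_atBot_nhdsGT.frequently
    ((main.and_eventually (eventually_lt_atBot T)).mono ?_)
  rintro t ⟨hlt, ht⟩
  refine lt_of_eq_of_lt ?_ hlt
  rw [← intervalIntegral.integral_const_mul]
  refine intervalIntegral.integral_congr fun θ _ => ?_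
  have hline : HasDerivAt (fun s : ℝ => p + s * Complex.exp (θ * Complex.I))
      (Complex.exp (θ * Complex.I)) (Real.exp t) := by
    simpa using ((Complex.ofRealCLM.hasDerivAt (x := Real.exp t)).mul_const
      (Complex.exp (θ * Complex.I))).const_add p
  have hz := hmem t ht θ
  rw [hEe] at hz
  have hpdr : pdr f p (Real.exp t) θ =
      D₁ (p + Real.exp t * Complex.exp (θ * Complex.I)) (Complex.exp (θ * Complex.I)) :=
    ((hD1 _ hz).comp_hasDerivAt (Real.exp t) hline).deriv
  simp only [hEe]
  rw [hpdr, ← Complex.real_smul, map_smul, smul_eq_mul, abs_mul, abs_of_pos (Real.exp_pos t)]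

/-- Let `U = B_R(p) ⊂ ℝ² ≅ ℂ` be an open disk centered at `p`, and let `f` be a bounded
function that is smooth on an open neighborhood `V` of the closure of `U` minus `{p}`,
whose Laplacian `Δf` is Lebesgue integrable on `U ∖ {p}`.  Then the flux of `f` through
small circles around `p` vanishes asymptotically along a subsequence:
`liminf_{ε→0⁺} ε ∫₀^{2π} |∂_r f(p + ε e^{iθ})| dθ = 0`; in particular
`liminf_{ε→0⁺} |∫_{∂B_ε(p)} ⋆df| = liminf_{ε→0⁺} |ε ∫₀^{2π} ∂_r f(p + ε e^{iθ}) dθ| = 0`. -/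
theorem stmt7 (p : ℂ) (R : ℝ) (hR : 0 < R) (f : ℂ → ℝ)
    (V : Set ℂ) (hVopen : IsOpen V) (hUV : closure (Metric.ball p R) ⊆ V)
    (hf : ContDiffOn ℝ (⊤ : ℕ∞) f (V \ {p}))
    (hbd : ∃ M, ∀ z ∈ V \ {p}, |f z| ≤ M)
    (hint : IntegrableOn (pLaplacian f) (Metric.ball p R \ {p}) volume) :
    Filter.liminf (fun ε : ℝ => ε * ∫ θ in (0 : ℝ)..(2 * Real.pi), |pdr f p ε θ|)
        (nhdsWithin 0 (Set.Ioi 0)) = 0 ∧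
    Filter.liminf (fun ε : ℝ => |ε * ∫ θ in (0 : ℝ)..(2 * Real.pi), pdr f p ε θ|)
        (nhdsWithin 0 (Set.Ioi 0)) = 0 := by
  obtain ⟨M, hM⟩ := hbd
  have hW : IsOpen (V \ {p}) := hVopen.sdiff isClosed_singleton
  have key : ∀ c > 0, ∃ᶠ ε in 𝓝[>] (0 : ℝ),
      ε * ∫ θ in (0 : ℝ)..(2 * Real.pi), |pdr f p ε θ| < c := fun c hc =>
    frequently_radial_flux_lt hR hW (sdiff_subset_sdiff_left (subset_closure.trans hUV))
      (hf.of_le (by norm_cast)) hM hint hc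
  have hpos : ∀ᶠ ε : ℝ in 𝓝[>] 0, 0 < ε := self_mem_nhdsWithin
  refine ⟨liminf_eq_zero_of_frequently_lt ?_ key,
    liminf_eq_zero_of_frequently_lt (.of_forall fun _ => abs_nonneg _) fun c hc => ?_⟩
  · filter_upwards [hpos] with ε hε
    exact mul_nonneg hε.le
      (intervalIntegral.integral_nonneg Real.two_pi_pos.le fun _ _ => abs_nonneg _)
  · refine ((key c hc).and_eventually hpos).mono ?_
    rintro ε ⟨hlt, hε⟩
    refine lt_of_le_of_lt ?_ hlt
    rw [abs_mul, abs_of_pos hε]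
    exact mul_le_mul_of_nonneg_left
      (intervalIntegral.abs_integral_le_integral_abs Real.two_pi_pos.le) hε.le
end
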